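/- Let L and M be preprojective k(Γ,Λ)-modules. Then S_L ⪯ S_M if and only if for each indecomposable direct summand X of L there exists an indecomposable direct summand Y of M satisfying S_X ⪯ S_Y. -/

import Mathlib

namespace KP

/-! ## Quivers on a fixed vertex set `Fin n`.

An orientation is encoded by `Λ : Fin n → Fin n → ℕ`, where `Λ a b` is the number of
arrows from `a` to `b`.  The underlying graph is recorded by `edges Λ a b = Λ a b + Λ b a`. -/

/-- The orientation `σ_x Λ` obtained by reversing every arrow incident with `x`. -/
def flipO {n : ℕ} (x : Fin n) (Λ : Fin n → Fin n → ℕ) : Fin n → Fin n → ℕ :=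
  fun a b => if a = x ∨ b = x then Λ b a else Λ a b

/-- Number of edges of the underlying graph joining `a` and `b`. -/
def edges {n : ℕ} (Λ : Fin n → Fin n → ℕ) (a b : Fin n) : ℕ := Λ a b + Λ b a

/-- `x` is a sink: no arrow starts at `x`. -/
def IsSink {n : ℕ} (Λ : Fin n → Fin n → ℕ) (x : Fin n) : Prop := ∀ y, Λ x y = 0

/-- `S` is a `(+)`-admissible sequence of vertices on `(Γ, Λ)`. -/
def Admissible {n : ℕ} (Λ : Fin n → Fin n → ℕ) : List (Fin n) → Prop
  | [] => True
  | x :: xs => IsSink Λ x ∧ Admissible (flipO x Λ) xs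

/-- The orientation `Λ^S`. -/
def orientAfter {n : ℕ} (Λ : Fin n → Fin n → ℕ) : List (Fin n) → (Fin n → Fin n → ℕ)
  | [] => Λ
  | x :: xs => orientAfter (flipO x Λ) xs

/-- Elementary move: interchange two consecutive vertices not joined by an edge. -/
inductive SwapRel {n : ℕ} (E : Fin n → Fin n → ℕ) : List (Fin n) → List (Fin n) → Prop
  | swap (l₁ l₂ : List (Fin n)) (a b : Fin n) (h : E a b = 0) :
      SwapRel E (l₁ ++ a :: b :: l₂) (l₁ ++ b :: a :: l₂)

/-- The equivalence `∼` on sequences of vertices: reflexive–transitive closure of the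
(symmetric) relation `SwapRel`. -/
def Sim {n : ℕ} (E : Fin n → Fin n → ℕ) : List (Fin n) → List (Fin n) → Prop :=
  Relation.ReflTransGen (SwapRel E)

/-- The preorder `S ⪯ T` : `T ∼ S ++ U` for some `(+)`-admissible sequence `U` on `(Γ, Λ^S)`. -/
def Preceq {n : ℕ} (Λ : Fin n → Fin n → ℕ) (S T : List (Fin n)) : Prop :=
  ∃ U, Admissible (orientAfter Λ S) U ∧ Sim (edges Λ) T (S ++ U)

/-- Support of a sequence of vertices. -/
def suppOf {n : ℕ} (S : List (Fin n)) : Set (Fin n) := {v | v ∈ S}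

/-- The partial order on vertices: `x ≤ y` iff there is a path from `x` to `y` in `(Γ, Λ)`. -/
def PathLE {n : ℕ} (Λ : Fin n → Fin n → ℕ) (x y : Fin n) : Prop :=
  Relation.ReflTransGen (fun a b => Λ a b ≠ 0) x y

/-- A filter (up-closed set) of the poset `(Γ₀, Λ)`. -/
def IsFilter {n : ℕ} (Λ : Fin n → Fin n → ℕ) (F : Set (Fin n)) : Prop :=
  ∀ x ∈ F, ∀ y, PathLE Λ x y → y ∈ F

/-- The principal filter `⟨x⟩`. -/
def upSet {n : ℕ} (Λ : Fin n → Fin n → ℕ) (x : Fin n) : Set (Fin n) := {y | PathLE Λ x y}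

/-- The hull `H_Λ(F)`: the smallest filter containing `F` and every vertex joined
by an edge to a vertex of `F`. -/
def hull {n : ℕ} (Λ : Fin n → Fin n → ℕ) (F : Set (Fin n)) : Set (Fin n) :=
  {y | ∃ x, (x ∈ F ∨ ∃ z ∈ F, edges Λ z x ≠ 0) ∧ PathLE Λ x y}

/-- `segs` is a canonical form of `S` (Proposition 2.1): `S ∼ S₁S₂⋯S_r`, each segment
consists of distinct vertices, is nonempty, and `Supp S_i = Supp (S_i S_{i+1} ⋯ S_r)`. -/
def Segments {n : ℕ} (Λ : Fin n → Fin n → ℕ) (S : List (Fin n))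
    (segs : List (List (Fin n))) : Prop :=
  Admissible Λ segs.flatten ∧ Sim (edges Λ) S segs.flatten ∧
  (∀ seg ∈ segs, seg ≠ [] ∧ seg.Nodup) ∧
  ∀ i, i < segs.length → suppOf (segs.getD i []) = suppOf ((segs.drop i).flatten)

/-- `J` is (a representative of) the join `S ∨ T` (Definition 2.4):  the canonical form of `J`
has `Supp R_i = Supp S_i ∪ Supp T_i` (out-of-range segments read as `∅`). -/
def IsJoin {n : ℕ} (Λ : Fin n → Fin n → ℕ) (S T J : List (Fin n)) : Prop :=
  ∃ CS CT CJ, Segments Λ S CS ∧ Segments Λ T CT ∧ Segments Λ J CJ ∧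
    ∀ i, suppOf (CJ.getD i []) = suppOf (CS.getD i []) ∪ suppOf (CT.getD i [])

/-- `M` is (a representative of) the meet `S ∧ T` (Definition 2.4). -/
def IsMeet {n : ℕ} (Λ : Fin n → Fin n → ℕ) (S T M : List (Fin n)) : Prop :=
  ∃ CS CT CM, Segments Λ S CS ∧ Segments Λ T CT ∧ Segments Λ M CM ∧
    ∀ i, suppOf (CM.getD i []) = suppOf (CS.getD i []) ∩ suppOf (CT.getD i [])

/-- `S` is (equivalent to) the join `T₁ ∨ ⋯ ∨ T_l` of the list of sequences `Ts`. -/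
def IsJoinList {n : ℕ} (Λ : Fin n → Fin n → ℕ) : List (List (Fin n)) → List (Fin n) → Prop
  | [], S => S = []
  | T :: Ts, S => ∃ J, IsJoinList Λ Ts J ∧ IsJoin Λ T J S

/-- The segments of a canonical form of a principal sequence `S_{r,x}` (Definition 3.1). -/
def PrincipalSegs {n : ℕ} (Λ : Fin n → Fin n → ℕ) (segs : List (List (Fin n)))
    (r : ℕ) (x : Fin n) : Prop :=
  segs.length = r ∧ 0 < r ∧
  (∀ i, i + 1 < r → suppOf (segs.getD i []) = hull Λ (suppOf (segs.getD (i+1) []))) ∧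
  suppOf (segs.getD (r-1) []) = upSet Λ x

/-- `S ∼ S_{r,x}`, the principal `(+)`-admissible sequence of size `r` with
`Supp S_r = ⟨x⟩`. -/
def IsPrincipalSeq {n : ℕ} (Λ : Fin n → Fin n → ℕ) (r : ℕ) (x : Fin n)
    (S : List (Fin n)) : Prop :=
  ∃ segs, Segments Λ S segs ∧ PrincipalSegs Λ segs r x

/-- `S` is a principal `(+)`-admissible sequence. -/
def IsPrincipal {n : ℕ} (Λ : Fin n → Fin n → ℕ) (S : List (Fin n)) : Prop :=
  ∃ r x, IsPrincipalSeq Λ r x S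


/-! ## Representations of `(Γ, Λ)` over a field `k`. -/

/-- A (finite-dimensional) representation of the quiver `(Γ, Λ)` over `k`:
the space at vertex `x` is `Fin (d x) → k`, and each arrow carries a linear map. -/
structure Rep (k : Type) [Field k] (n : ℕ) (Λ : Fin n → Fin n → ℕ) where
  d : Fin n → ℕ
  f : ∀ a b : Fin n, Fin (Λ a b) → ((Fin (d a) → k) →ₗ[k] (Fin (d b) → k))

variable {k : Type} [Field k] {n : ℕ}

/-- A morphism of representations. -/
structure RepHom {Λ : Fin n → Fin n → ℕ} (M N : Rep k n Λ) where
  g : ∀ x, (Fin (M.d x) → k) →ₗ[k] (Fin (N.d x) → k)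
  comm : ∀ a b i v, g b (M.f a b i v) = N.f a b i (g a v)

/-- Isomorphism of representations. -/
def RepIso {Λ : Fin n → Fin n → ℕ} (M N : Rep k n Λ) : Prop :=
  ∃ g : ∀ x, (Fin (M.d x) → k) ≃ₗ[k] (Fin (N.d x) → k),
    ∀ a b i v, g b (M.f a b i v) = N.f a b i (g a v)

/-- The zero representation. -/
def IsZeroRep {Λ : Fin n → Fin n → ℕ} (M : Rep k n Λ) : Prop := ∀ x, M.d x = 0

/-- Cast between the standard spaces. -/
def castL (k : Type) [Field k] {m m' : ℕ} (h : m = m') : (Fin m → k) ≃ₗ[k] (Fin m' → k) :=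
  LinearEquiv.funCongrLeft k k (finCongr h.symm)

/-- The splitting `(Fin (m + p) → k) ≃ₗ (Fin m → k) × (Fin p → k)`. -/
def splitL (k : Type) [Field k] (m p : ℕ) : (Fin (m + p) → k) ≃ₗ[k] (Fin m → k) × (Fin p → k) :=
  (LinearEquiv.funCongrLeft k k finSumFinEquiv).trans
    (LinearEquiv.sumArrowLequivProdArrow _ _ k k)

/-- Direct sum of two representations. -/
def dSum {Λ : Fin n → Fin n → ℕ} (M N : Rep k n Λ) : Rep k n Λ where
  d x := M.d x + N.d x
  f a b i :=
    (splitL k (M.d b) (N.d b)).symm.toLinearMap ∘ₗ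
      (LinearMap.prodMap (M.f a b i) (N.f a b i)) ∘ₗ (splitL k (M.d a) (N.d a)).toLinearMap

/-- The zero representation (as an object). -/
def zeroRep (k : Type) [Field k] (n : ℕ) (Λ : Fin n → Fin n → ℕ) : Rep k n Λ where
  d _ := 0
  f _ _ _ := 0

/-- Direct sum of a list of representations. -/
def dSumList {Λ : Fin n → Fin n → ℕ} (L : List (Rep k n Λ)) : Rep k n Λ :=
  L.foldr dSum (zeroRep k n Λ)

/-- `M` is indecomposable. -/
def Indecomp {Λ : Fin n → Fin n → ℕ} (M : Rep k n Λ) : Prop :=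
  ¬ IsZeroRep M ∧ ∀ A B : Rep k n Λ, RepIso M (dSum A B) → IsZeroRep A ∨ IsZeroRep B

/-- `X` is a direct summand of `M`. -/
def IsSummand {Λ : Fin n → Fin n → ℕ} (X M : Rep k n Λ) : Prop :=
  ∃ Y, RepIso M (dSum X Y)

/-! ### Reflection functors (on objects) -/

/-- Index type of the arrows ending at `x`. -/
abbrev Arin {n : ℕ} (Λ : Fin n → Fin n → ℕ) (x : Fin n) := Σ y : Fin n, Fin (Λ y x)

/-- Index type of the arrows starting at `x`. -/
abbrev Aout {n : ℕ} (Λ : Fin n → Fin n → ℕ) (x : Fin n) := Σ y : Fin n, Fin (Λ x y)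

/-- The map `h : ⊕_{a : y → x} V(y) → V(x)` induced by the maps along the arrows ending at `x`. -/
noncomputable def inMap (Λ : Fin n → Fin n → ℕ) (M : Rep k n Λ) (x : Fin n) :
    ((p : Arin Λ x) → (Fin (M.d p.1) → k)) →ₗ[k] (Fin (M.d x) → k) :=
  ∑ p : Arin Λ x, (M.f p.1 x p.2) ∘ₗ LinearMap.proj p

/-- The map `h' : V(x) → ⊕_{a : x → y} V(y)` induced by the maps along arrows starting at `x`. -/
def outMap (Λ : Fin n → Fin n → ℕ) (M : Rep k n Λ) (x : Fin n) :
    (Fin (M.d x) → k) →ₗ[k] ((p : Aout Λ x) → (Fin (M.d p.1) → k)) :=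
  LinearMap.pi fun p => M.f x p.1 p.2

noncomputable def kerEquiv (Λ : Fin n → Fin n → ℕ) (M : Rep k n Λ) (x : Fin n) :
    LinearMap.ker (inMap Λ M x) ≃ₗ[k]
      (Fin (Module.finrank k (LinearMap.ker (inMap Λ M x))) → k) :=
  (Module.finBasis k _).equivFun

noncomputable def cokerEquiv (Λ : Fin n → Fin n → ℕ) (M : Rep k n Λ) (x : Fin n) :
    (((p : Aout Λ x) → (Fin (M.d p.1) → k)) ⧸ LinearMap.range (outMap Λ M x)) ≃ₗ[k]
      (Fin (Module.finrank k (((p : Aout Λ x) → (Fin (M.d p.1) → k)) ⧸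
        LinearMap.range (outMap Λ M x))) → k) :=
  (Module.finBasis k _).equivFun

/-- The positive reflection functor `F_x⁺` (on objects): the space at `x` is replaced
by the kernel of `inMap`, with the maps along the reversed arrows induced by inclusion
followed by the projections. -/
noncomputable def reflPlus (x : Fin n) (Λ : Fin n → Fin n → ℕ) (M : Rep k n Λ) :
    Rep k n (flipO x Λ) where
  d z := if z = x then Module.finrank k (LinearMap.ker (inMap Λ M x)) else M.d z
  f a b i :=
    if ha : a = x then
      if hb : b = x then 0
      else
        (castL k (if_neg hb).symm).toLinearMap ∘ₗ
          (LinearMap.proj (φ := fun p : Arin Λ x => Fin (M.d p.1) → k)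
            (⟨b, Fin.cast (by subst ha; simp [flipO]) i⟩ : Arin Λ x)) ∘ₗ
          (LinearMap.ker (inMap Λ M x)).subtype ∘ₗ
          (kerEquiv Λ M x).symm.toLinearMap ∘ₗ (castL k (if_pos ha)).toLinearMap
    else
      if hb : b = x then 0
      else
        (castL k (if_neg hb).symm).toLinearMap ∘ₗ
          M.f a b (Fin.cast (by simp [flipO, ha, hb]) i) ∘ₗ
          (castL k (if_neg ha)).toLinearMap

/-- The negative reflection functor `F_x⁻` (on objects), presented as a map from
representations of `(Γ, σ_x Λ)` to representations of `(Γ, Λ)`: the space at `x` is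
replaced by the cokernel of `outMap`. -/
noncomputable def reflMinus (x : Fin n) (Λ : Fin n → Fin n → ℕ)
    (N : Rep k n (flipO x Λ)) : Rep k n Λ where
  d z := if z = x then
      Module.finrank k (((p : Aout (flipO x Λ) x) → (Fin (N.d p.1) → k)) ⧸
        LinearMap.range (outMap (flipO x Λ) N x))
    else N.d z
  f a b i :=
    if hb : b = x then
      if ha : a = x then 0
      else
        (castL k (if_pos hb).symm).toLinearMap ∘ₗ
          (cokerEquiv (flipO x Λ) N x).toLinearMap ∘ₗ
          (LinearMap.range (outMap (flipO x Λ) N x)).mkQ ∘ₗ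
          (LinearMap.single k (fun p : Aout (flipO x Λ) x => Fin (N.d p.1) → k)
            (⟨a, Fin.cast (by subst hb; simp [flipO]) i⟩ : Aout (flipO x Λ) x)) ∘ₗ
          (castL k (if_neg ha)).toLinearMap
    else
      if ha : a = x then 0
      else
        (castL k (if_neg hb).symm).toLinearMap ∘ₗ
          N.f a b (Fin.cast (by simp [flipO, ha, hb]) i) ∘ₗ
          (castL k (if_neg ha)).toLinearMap

/-- `F(S) = F_{x_s}⁺ ⋯ F_{x_1}⁺` applied to a representation. -/
noncomputable def FList : (S : List (Fin n)) → (Λ : Fin n → Fin n → ℕ) → Rep k n Λ →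
    Rep k n (orientAfter Λ S)
  | [], _, M => M
  | x :: xs, Λ, M => FList xs (flipO x Λ) (reflPlus x Λ M)

/-- `S` annihilates `M` : `F(S) M = 0`. -/
def Annihilates (Λ : Fin n → Fin n → ℕ) (S : List (Fin n)) (M : Rep k n Λ) : Prop :=
  IsZeroRep (FList S Λ M)

/-- `M` is preprojective: some `(+)`-admissible sequence annihilates it. -/
def Preprojective (Λ : Fin n → Fin n → ℕ) (M : Rep k n Λ) : Prop :=
  ∃ S, Admissible Λ S ∧ Annihilates Λ S M

/-- `S` is a shortest `(+)`-admissible sequence annihilating `M` : it annihilates `M` and no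
proper subsequence of `S` annihilates `M`.  (This predicate is invariant under `∼`, so it
expresses `S ∼ S_M`.) -/
def IsShortestAnn (Λ : Fin n → Fin n → ℕ) (M : Rep k n Λ) (S : List (Fin n)) : Prop :=
  Admissible Λ S ∧ Annihilates Λ S M ∧
  ∀ S', Admissible Λ S' → Annihilates Λ S' M → Preceq Λ S' S → Sim (edges Λ) S' S

/-- The simple representation `L_x` concentrated at the vertex `x`. -/
def simpleRep (Λ : Fin n → Fin n → ℕ) (x : Fin n) : Rep k n Λ where
  d z := if z = x then 1 else 0
  f _ _ _ := 0

/-- `M(S) = F_{x₁}⁻ F_{x₂}⁻ ⋯ F_{x_{s-1}}⁻ (L_{x_s})`, where `L_{x_s}` is the simple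
(projective) module over `k(Γ, σ_{x_{s-1}} ⋯ σ_{x_1} Λ)` at the vertex `x_s`. -/
noncomputable def Mof : (Λ : Fin n → Fin n → ℕ) → (S : List (Fin n)) → Rep k n Λ
  | Λ, [] => zeroRep k n Λ
  | Λ, [x] => simpleRep Λ x
  | Λ, x :: y :: ys => reflMinus x Λ (Mof (flipO x Λ) (y :: ys))

variable {n : ℕ}

/-! ## The Weyl group -/

/-- The simple reflection `σ_i` attached to a generalized Cartan matrix `A`,
as a linear endomorphism of `ℤⁿ` : `σ_i(v) = v - (∑ l, a_{il} v_l) e_i`. -/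
def sigmaL (A : Fin n → Fin n → ℤ) (i : Fin n) : (Fin n → ℤ) →ₗ[ℤ] (Fin n → ℤ) where
  toFun v := v - (∑ l, A i l * v l) • Pi.single i 1
  map_add' v w := by
    simp only [Pi.add_apply, mul_add, Finset.sum_add_distrib, add_smul]
    abel
  map_smul' c v := by
    simp only [Pi.smul_apply, smul_eq_mul, RingHom.id_apply, smul_sub]
    congr 1
    rw [smul_smul, Finset.mul_sum]
    congr 1
    exact Finset.sum_congr rfl fun l _ => by ring

theorem sigma_invol (A : Fin n → Fin n → ℤ) (hA : ∀ i, A i i = 2) (i : Fin n) :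
    (sigmaL A i).comp (sigmaL A i) = LinearMap.id := by
  apply LinearMap.ext
  intro v
  simp only [LinearMap.comp_apply, LinearMap.id_apply, sigmaL, LinearMap.coe_mk, AddHom.coe_mk]
  set c := ∑ l, A i l * v l with hc
  set s : Fin n → ℤ := Pi.single i 1 with hs
  have h1 : ∑ l, A i l * (v - c • s) l = -c := by
    have h2 : ∀ l, A i l * (v - c • s) l = A i l * v l - c * (A i l * s l) := fun l => by
      simp only [Pi.sub_apply, Pi.smul_apply, smul_eq_mul]
      ring
    rw [Finset.sum_congr rfl fun l _ => h2 l, Finset.sum_sub_distrib, ← Finset.mul_sum]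
    have h3 : ∑ l, A i l * s l = 2 := by
      rw [Finset.sum_eq_single i]
      · simp [hs, hA i]
      · intro b _ hb
        simp [hs, Pi.single_eq_of_ne hb]
      · simp
    rw [h3, ← hc]
    ring
  rw [h1]
  ext j
  simp only [Pi.sub_apply, Pi.smul_apply, smul_eq_mul]
  ring

/-- The simple reflection `σ_i` as an automorphism of `ℤⁿ`. -/
def sigmaE (A : Fin n → Fin n → ℤ) (hA : ∀ i, A i i = 2) (i : Fin n) :
    (Fin n → ℤ) ≃ₗ[ℤ] (Fin n → ℤ) :=
  LinearEquiv.ofLinear (sigmaL A i) (sigmaL A i) (sigma_invol A hA i) (sigma_invol A hA i)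

/-- The length `ℓ(w)`: the least `l ≥ 0` such that `w` is a product of `l` simple
reflections. -/
noncomputable def wordLen (A : Fin n → Fin n → ℤ) (hA : ∀ i, A i i = 2)
    (w : (Fin n → ℤ) ≃ₗ[ℤ] (Fin n → ℤ)) : ℕ :=
  sInf {l | ∃ ys : List (Fin n), ys.length = l ∧ w = (ys.map (sigmaE A hA)).prod}

/-- The word `w(S) = σ_{x_s} ⋯ σ_{x_1}` associated to a sequence `S = x₁, …, x_s`. -/
def wordOf (A : Fin n → Fin n → ℤ) (hA : ∀ i, A i i = 2) (S : List (Fin n)) :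
    (Fin n → ℤ) ≃ₗ[ℤ] (Fin n → ℤ) :=
  ((S.reverse).map (sigmaE A hA)).prod

/-- The symmetric generalized Cartan matrix of the underlying graph of `(Γ, Λ)`. -/
def cartanOf (Λ : Fin n → Fin n → ℕ) : Fin n → Fin n → ℤ :=
  fun i j => if i = j then 2 else -(edges Λ i j : ℤ)

theorem cartan_diag (Λ : Fin n → Fin n → ℕ) : ∀ i, cartanOf Λ i i = 2 := by
  intro i; simp [cartanOf]

/-- The simple reflections of the Weyl group of the underlying graph of `(Γ, Λ)`. -/
def wSig (Λ : Fin n → Fin n → ℕ) : Fin n → ((Fin n → ℤ) ≃ₗ[ℤ] (Fin n → ℤ)) :=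
  sigmaE (cartanOf Λ) (cartan_diag Λ)

/-- `w(S)` for a sequence of vertices of `(Γ, Λ)`. -/
def wordOfSeq (Λ : Fin n → Fin n → ℕ) (S : List (Fin n)) :
    (Fin n → ℤ) ≃ₗ[ℤ] (Fin n → ℤ) :=
  ((S.reverse).map (wSig Λ)).prod

/-- The word `w(S)` is reduced: `ℓ(w(S))` equals the number of letters of `S`. -/
noncomputable def IsReducedSeq (Λ : Fin n → Fin n → ℕ) (S : List (Fin n)) : Prop :=
  wordLen (cartanOf Λ) (cartan_diag Λ) (wordOfSeq Λ S) = S.length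

/-! ## Dynkin graphs of types A, D, E -/

def edgeA (n : ℕ) : Fin n → Fin n → ℕ := fun i j =>
  if (i : ℕ) + 1 = (j : ℕ) ∨ (j : ℕ) + 1 = (i : ℕ) then 1 else 0

def edgeD (n : ℕ) : Fin n → Fin n → ℕ := fun i j =>
  if ((i : ℕ) = 0 ∧ (j : ℕ) = 2) ∨ ((j : ℕ) = 0 ∧ (i : ℕ) = 2) ∨
     ((i : ℕ) = 1 ∧ (j : ℕ) = 2) ∨ ((j : ℕ) = 1 ∧ (i : ℕ) = 2) ∨
     (2 ≤ (i : ℕ) ∧ (i : ℕ) + 1 = (j : ℕ)) ∨ (2 ≤ (j : ℕ) ∧ (j : ℕ) + 1 = (i : ℕ))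
  then 1 else 0

def edgeE (n : ℕ) : Fin n → Fin n → ℕ := fun i j =>
  if ((i : ℕ) + 1 = (j : ℕ) ∧ (j : ℕ) ≤ n - 2) ∨ ((j : ℕ) + 1 = (i : ℕ) ∧ (i : ℕ) ≤ n - 2) ∨
     ((i : ℕ) = 2 ∧ (j : ℕ) = n - 1) ∨ ((j : ℕ) = 2 ∧ (i : ℕ) = n - 1)
  then 1 else 0

/-- The underlying graph (given by its edge-count function `E`) is a Dynkin diagram of
type `A`, `D`, or `E`. -/
def IsDynkinADE (n : ℕ) (E : Fin n → Fin n → ℕ) : Prop :=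
  ∃ e : Fin n ≃ Fin n,
    (∀ i j, E i j = edgeA n (e i) (e j)) ∨
    (4 ≤ n ∧ ∀ i j, E i j = edgeD n (e i) (e j)) ∨
    ((n = 6 ∨ n = 7 ∨ n = 8) ∧ ∀ i j, E i j = edgeE n (e i) (e j))

/-! ## Coxeter-sortable elements -/

/-- Lexicographic comparison of index tuples. -/
def lexLE {s : ℕ} (ι ι' : Fin s → ℕ) : Prop :=
  ι = ι' ∨ ∃ j, (∀ j', j' < j → ι j' = ι' j') ∧ ι j < ι' j

/-- `w` is `c`-sortable for the Coxeter element determined by the half-infinite word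
`cseq` (with dividers every `blockLen` letters): the lexicographically first subsequence
of `cseq` that is a reduced word for `w` defines a sequence of subsets (between adjacent
dividers) that is decreasing under inclusion. -/
def CSortable (A : Fin n → Fin n → ℤ) (hA : ∀ i, A i i = 2) (cseq : ℕ → Fin n)
    (blockLen : ℕ) (w : (Fin n → ℤ) ≃ₗ[ℤ] (Fin n → ℤ)) : Prop :=
  ∃ (s : ℕ) (ι : Fin s → ℕ), StrictMono ι ∧
    w = ((List.ofFn fun j => cseq (ι j)).map (sigmaE A hA)).prod ∧
    wordLen A hA w = s ∧
    (∀ ι' : Fin s → ℕ, StrictMono ι' →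
      w = ((List.ofFn fun j => cseq (ι' j)).map (sigmaE A hA)).prod → lexLE ι ι') ∧
    ∀ m : ℕ, {a : Fin n | ∃ j, (ι j) / blockLen = m + 1 ∧ cseq (ι j) = a} ⊆
             {a : Fin n | ∃ j, (ι j) / blockLen = m ∧ cseq (ι j) = a}


/-- A nonzero non-isomorphism between representations. -/
def RepStep {k : Type} [Field k] {n : ℕ} {Λ : Fin n → Fin n → ℕ} (X Y : Rep k n Λ) : Prop :=
  ∃ f : RepHom X Y, (∃ x v, f.g x v ≠ 0) ∧ ¬ ∀ x, Function.Bijective (f.g x)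

/-- `v` is a minimal element of `D` in the poset `(Γ₀, Λ)`. -/
def MinimalIn {n : ℕ} (Λ : Fin n → Fin n → ℕ) (D : Set (Fin n)) (v : Fin n) : Prop :=
  v ∈ D ∧ ∀ u ∈ D, PathLE Λ u v → u = v

/-- The pairs `(h, v)` of Proposition 3.2(a): `0 < h ≤ r` and `v` a minimal element of
`Supp S_h \ H_Λ(Supp S_{h+1})` (with `Supp S_{r+1} = ∅`). -/
def JoinPair {n : ℕ} (Λ : Fin n → Fin n → ℕ) (segs : List (List (Fin n)))
    (p : ℕ × Fin n) : Prop :=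
  0 < p.1 ∧ p.1 ≤ segs.length ∧
  MinimalIn Λ (suppOf (segs.getD (p.1 - 1) []) \ hull Λ (suppOf (segs.getD p.1 []))) p.2

/-! ## Combinatorics of admissible sequences -/

theorem flip_comm (x y : Fin n) (Λ : Fin n → Fin n → ℕ) :
    flipO x (flipO y Λ) = flipO y (flipO x Λ) := by
  funext a b
  unfold flipO
  by_cases h1 : a = x <;> by_cases h2 : b = x <;> by_cases h3 : a = y <;> by_cases h4 : b = y <;>
    simp [h1, h2, h3, h4]

theorem edges_flip (x : Fin n) (Λ : Fin n → Fin n → ℕ) : edges (flipO x Λ) = edges Λ := by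
  funext a b
  unfold edges flipO
  by_cases h1 : a = x <;> by_cases h2 : b = x <;> simp [h1, h2, add_comm]

theorem flip_off {x a b : Fin n} {Λ : Fin n → Fin n → ℕ} (ha : a ≠ x) (hb : b ≠ x) :
    flipO x Λ a b = Λ a b := by simp [flipO, ha, hb]

theorem flip_row (x b : Fin n) (Λ : Fin n → Fin n → ℕ) : flipO x Λ x b = Λ b x := by
  simp [flipO]

theorem flip_col (x b : Fin n) (Λ : Fin n → Fin n → ℕ) : flipO x Λ b x = Λ x b := by
  simp [flipO]

theorem sink_flip {x y : Fin n} {Λ : Fin n → Fin n → ℕ} (hne : x ≠ y)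
    (hx : IsSink Λ x) (hy : IsSink Λ y) : IsSink (flipO y Λ) x := by
  intro z
  by_cases h : z = y
  · subst h; rw [flip_col]; exact hy x
  · rw [flip_off hne h]; exact hx z

theorem Sim.cons {E : Fin n → Fin n → ℕ} {S T : List (Fin n)} (x : Fin n) (h : Sim E S T) :
    Sim E (x :: S) (x :: T) := by
  induction h with
  | refl => exact Relation.ReflTransGen.refl
  | tail _ h ih =>
    refine ih.tail ?_
    cases h with
    | swap l₁ l₂ a b hab => exact SwapRel.swap (x :: l₁) l₂ a b hab

theorem Sim.perm {E : Fin n → Fin n → ℕ} {S T : List (Fin n)} (h : Sim E S T) : S.Perm T := by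
  induction h with
  | refl => exact List.Perm.refl _
  | tail _ h ih =>
    refine ih.trans ?_
    cases h with
    | swap l₁ l₂ a b hab => exact List.Perm.append_left _ (List.Perm.swap _ _ _)

/-- A sink occurring in an admissible sequence can be moved to the front. -/
theorem front {x : Fin n} : ∀ {T : List (Fin n)} {Λ : Fin n → Fin n → ℕ}, IsSink Λ x →
    Admissible Λ T → x ∈ T →
    Admissible (flipO x Λ) (T.erase x) ∧ Sim (edges Λ) T (x :: T.erase x) := by
  intro T
  induction T with
  | nil => intro Λ _ _ h; simp at h
  | cons y T ih =>
    intro Λ hx hT hm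
    by_cases hxy : y = x
    · subst hxy
      simp only [List.erase_cons_head]
      exact ⟨hT.2, Relation.ReflTransGen.refl⟩
    · have hm' : x ∈ T := by
        rcases List.mem_cons.1 hm with h | h
        · exact absurd h.symm hxy
        · exact h
      have hne : x ≠ y := fun h => hxy h.symm
      obtain ⟨h1, h2⟩ := ih (sink_flip hne hx hT.1) hT.2 hm'
      rw [List.erase_cons_tail (by simpa using hxy)]
      refine ⟨⟨sink_flip hxy hT.1 hx, ?_⟩, ?_⟩
      · rw [flip_comm]; exact h1
      · rw [edges_flip] at h2
        refine (h2.cons y).tail ?_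
        refine SwapRel.swap [] _ y x ?_
        simp [edges, hT.1 x, hx y]

theorem adm_append_sink {x : Fin n} : ∀ {T : List (Fin n)} {Λ : Fin n → Fin n → ℕ}, IsSink Λ x →
    Admissible Λ T → x ∉ T → Admissible Λ (T ++ [x]) := by
  intro T
  induction T with
  | nil => intro Λ hx _ _; exact ⟨hx, trivial⟩
  | cons y T ih =>
    intro Λ hx hT hm
    simp only [List.mem_cons, not_or] at hm
    exact ⟨hT.1, ih (sink_flip hm.1 hx hT.1) hT.2 hm.2⟩

theorem adm_flip_of_notMem {x : Fin n} {T : List (Fin n)} {Λ : Fin n → Fin n → ℕ}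
    (hx : IsSink Λ x) (hT : Admissible Λ T) (hm : x ∉ T) : Admissible (flipO x Λ) T := by
  have := (front hx (adm_append_sink hx hT hm) (by simp)).1
  rwa [List.erase_append_right _ hm, List.erase_cons_head, List.append_nil] at this

theorem nbr_notMem {x b : Fin n} : ∀ {T : List (Fin n)} {Λ : Fin n → Fin n → ℕ}, IsSink Λ x →
    Admissible Λ T → x ∉ T → Λ b x ≠ 0 → b ∉ T := by
  intro T
  induction T with
  | nil => intros; simp
  | cons y T ih =>
    intro Λ hx hT hm hb
    simp only [List.mem_cons, not_or] at hm ⊢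
    have hby : b ≠ y := by rintro rfl; exact hb (hT.1 x)
    refine ⟨hby, ih (sink_flip hm.1 hx hT.1) hT.2 hm.2 ?_⟩
    rwa [flip_off hby hm.1]

/-- Undo a flip at `x` for a sequence avoiding `x` and its neighbours. -/
theorem adm_unflip {x : Fin n} : ∀ {R : List (Fin n)} {Λ : Fin n → Fin n → ℕ}, IsSink Λ x →
    Admissible (flipO x Λ) R → x ∉ R → (∀ b, Λ b x ≠ 0 → b ∉ R) → Admissible Λ R := by
  intro R
  induction R with
  | nil => intros; trivial
  | cons y R ih =>
    intro Λ hx hR hm hb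
    simp only [List.mem_cons, not_or] at hm hb
    have hyx : Λ y x = 0 := by
      by_contra h
      exact (hb y h).1 rfl
    have hys : IsSink Λ y := by
      intro z
      by_cases hz : z = x
      · subst hz; exact hyx
      · have := hR.1 z
        rwa [flip_off (Ne.symm hm.1) hz] at this
    refine ⟨hys, ih (sink_flip hm.1 hx hys) ?_ hm.2 ?_⟩
    · rw [flip_comm]; exact hR.2
    · intro b h
      by_cases hby : b = y
      · subst hby; rw [flip_row, hx] at h; exact absurd rfl h
      · rw [flip_off hby hm.1] at h
        exact (hb b h).2

theorem exists_meet : ∀ (S T : List (Fin n)) (Λ : Fin n → Fin n → ℕ), Admissible Λ S →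
    Admissible Λ T → ∃ R, Admissible Λ R ∧ ∀ v, R.count v = min (S.count v) (T.count v) := by
  intro S
  induction S with
  | nil => intro T Λ _ _; exact ⟨[], trivial, by simp⟩
  | cons x S ih =>
    intro T Λ hS hT
    by_cases hm : x ∈ T
    · obtain ⟨h1, h2⟩ := front hS.1 hT hm
      obtain ⟨R, hR, hc⟩ := ih _ _ hS.2 h1
      refine ⟨x :: R, ⟨hS.1, hR⟩, fun v => ?_⟩
      have hp := h2.perm.count_eq v
      rw [hp]
      simp only [List.count_cons, hc]
      omega
    · obtain ⟨R, hR, hc⟩ := ih _ _ hS.2 (adm_flip_of_notMem hS.1 hT hm)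
      have key : ∀ b, b ∉ T → b ∉ R := by
        intro b hb
        have := hc b
        rw [List.count_eq_zero_of_not_mem hb, Nat.min_zero] at this
        exact List.count_eq_zero.1 this
      refine ⟨R, adm_unflip hS.1 hR (key x hm)
        (fun b hb => key b (nbr_notMem hS.1 hT hm hb)), fun v => ?_⟩
      rw [hc, List.count_cons]
      by_cases hv : x = v
      · subst hv
        simp [List.count_eq_zero_of_not_mem hm]
      · simp [hv]

theorem exists_join : ∀ (S T : List (Fin n)) (Λ : Fin n → Fin n → ℕ), Admissible Λ S →
    Admissible Λ T → ∃ R, Admissible Λ R ∧ ∀ v, R.count v = max (S.count v) (T.count v) := by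
  intro S
  induction S with
  | nil => intro T Λ _ hT; exact ⟨T, hT, by simp⟩
  | cons x S ih =>
    intro T Λ hS hT
    by_cases hm : x ∈ T
    · obtain ⟨h1, h2⟩ := front hS.1 hT hm
      obtain ⟨R, hR, hc⟩ := ih _ _ hS.2 h1
      refine ⟨x :: R, ⟨hS.1, hR⟩, fun v => ?_⟩
      have hp := h2.perm.count_eq v
      rw [hp]
      simp only [List.count_cons, hc]
      omega
    · obtain ⟨R, hR, hc⟩ := ih _ _ hS.2 (adm_flip_of_notMem hS.1 hT hm)
      refine ⟨x :: R, ⟨hS.1, hR⟩, fun v => ?_⟩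
      rw [List.count_cons, hc, List.count_cons]
      by_cases hv : x = v
      · subst hv
        simp [List.count_eq_zero_of_not_mem hm]
      · simp [hv]

theorem front_of_count {x : Fin n} {S T : List (Fin n)} {Λ : Fin n → Fin n → ℕ}
    (hS : Admissible Λ (x :: S)) (hT : Admissible Λ T)
    (h : ∀ v, (x :: S).count v ≤ T.count v) :
    x ∈ T ∧ Admissible (flipO x Λ) (T.erase x) ∧ Sim (edges Λ) T (x :: T.erase x) ∧
      ∀ v, S.count v ≤ (T.erase x).count v := by
  have hm : x ∈ T := by
    have := h x
    rw [List.count_cons_self] at this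
    exact List.count_pos_iff.1 (by omega)
  obtain ⟨h1, h2⟩ := front hS.1 hT hm
  refine ⟨hm, h1, h2, fun v => ?_⟩
  have hp := h2.perm.count_eq v
  have := h v
  rw [hp] at this
  simp only [List.count_cons] at this
  omega

theorem preceq_of_count : ∀ (S T : List (Fin n)) (Λ : Fin n → Fin n → ℕ), Admissible Λ S →
    Admissible Λ T → (∀ v, S.count v ≤ T.count v) → Preceq Λ S T := by
  intro S
  induction S with
  | nil => intro T Λ _ hT _; exact ⟨T, hT, Relation.ReflTransGen.refl⟩
  | cons x S ih =>
    intro T Λ hS hT h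
    obtain ⟨_, h1, h2, h3⟩ := front_of_count hS hT h
    obtain ⟨U, hU, hs⟩ := ih _ _ hS.2 h1 h3
    rw [edges_flip] at hs
    exact ⟨U, hU, h2.trans (hs.cons x)⟩

theorem Preceq.count {S T : List (Fin n)} {Λ : Fin n → Fin n → ℕ} (h : Preceq Λ S T) (v : Fin n) :
    S.count v ≤ T.count v := by
  obtain ⟨U, _, hs⟩ := h
  rw [hs.perm.count_eq v, List.count_append]
  omega

theorem sim_of_count {S T : List (Fin n)} {Λ : Fin n → Fin n → ℕ} (hS : Admissible Λ S)
    (hT : Admissible Λ T) (h : ∀ v, S.count v = T.count v) : Sim (edges Λ) S T := by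
  obtain ⟨U, _, hs⟩ := preceq_of_count T S Λ hT hS (fun v => (h v).ge)
  have : U = [] := by
    rw [List.eq_nil_iff_forall_not_mem]
    intro v hv
    have := hs.perm.count_eq v
    rw [List.count_append, h v] at this
    have := List.count_pos_iff.2 hv
    omega
  rw [this, List.append_nil] at hs
  exact hs

/-! ## Raw representations: arrows indexed by `ℕ`, no dependence on the orientation -/

structure RR (k : Type) [Field k] (n : ℕ) where
  d : Fin n → ℕ
  f : ∀ a b : Fin n, ℕ → ((Fin (d a) → k) →ₗ[k] (Fin (d b) → k))

/-- The space at `z`. -/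
abbrev RR.V (M : RR k n) (z : Fin n) := Fin (M.d z) → k

@[reducible] def toRaw {Λ : Fin n → Fin n → ℕ} (M : Rep k n Λ) : RR k n where
  d := M.d
  f a b i := if h : i < Λ a b then M.f a b ⟨i, h⟩ else 0

theorem toRaw_f {Λ : Fin n → Fin n → ℕ} (M : Rep k n Λ) {a b : Fin n} {i : ℕ} (h : i < Λ a b) :
    (toRaw M).f a b i = M.f a b ⟨i, h⟩ := dif_pos h

@[reducible] def ofRaw (Λ : Fin n → Fin n → ℕ) (M : RR k n) : Rep k n Λ where
  d := M.d
  f a b i := M.f a b i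

def RZero (M : RR k n) : Prop := ∀ z, ∀ v : M.V z, v = 0

/-- The sum map at `x`. -/
noncomputable def insum (x : Fin n) (Λ : Fin n → Fin n → ℕ) (M : RR k n) :
    ((b : Fin n) → ℕ → M.V b) →ₗ[k] M.V x :=
  ∑ b, ∑ i ∈ Finset.range (Λ b x), M.f b x i ∘ₗ LinearMap.proj i ∘ₗ LinearMap.proj b

theorem insum_apply (x : Fin n) (Λ : Fin n → Fin n → ℕ) (M : RR k n)
    (w : (b : Fin n) → ℕ → M.V b) :
    insum x Λ M w = ∑ b, ∑ i ∈ Finset.range (Λ b x), M.f b x i (w b i) := by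
  simp [insum, LinearMap.sum_apply]

theorem insum_congr {x : Fin n} {Λ : Fin n → Fin n → ℕ} {M : RR k n}
    {w w' : (b : Fin n) → ℕ → M.V b} (h : ∀ b i, i < Λ b x → w b i = w' b i) :
    insum x Λ M w = insum x Λ M w' := by
  rw [insum_apply, insum_apply]
  refine Finset.sum_congr rfl fun b _ => Finset.sum_congr rfl fun i hi => ?_
  rw [h b i (Finset.mem_range.1 hi)]

theorem insum_single (x : Fin n) (Λ : Fin n → Fin n → ℕ) (M : RR k n) {a : Fin n} {i : ℕ}
    (hi : i < Λ a x) (u : M.V a) :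
    insum x Λ M (Pi.single a (Pi.single i u)) = M.f a x i u := by
  rw [insum_apply, Finset.sum_eq_single a, Finset.sum_eq_single i]
  · simp
  · intro j _ hj; simp [hj]
  · intro h; exact absurd (Finset.mem_range.2 hi) h
  · intro b _ hb; simp [hb]
  · simp

theorem insum_natural {x : Fin n} {Λ Λ' : Fin n → Fin n → ℕ} {M M' : RR k n}
    (g : ∀ z, M.V z →ₗ[k] M'.V z) (hΛ : ∀ b, Λ b x = Λ' b x)
    (hg : ∀ b i, i < Λ b x → ∀ v, g x (M.f b x i v) = M'.f b x i (g b v))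
    (w : (b : Fin n) → ℕ → M.V b) :
    g x (insum x Λ M w) = insum x Λ' M' (fun b i => g b (w b i)) := by
  rw [insum_apply, insum_apply, map_sum]
  refine Finset.sum_congr rfl fun b _ => ?_
  rw [map_sum, hΛ b]
  refine Finset.sum_congr rfl fun i hi => ?_
  rw [hg]
  rw [hΛ]
  exact Finset.mem_range.1 hi

def IsHom (Λ : Fin n → Fin n → ℕ) (M N : RR k n) (g : ∀ z, M.V z →ₗ[k] N.V z) : Prop :=
  ∀ a b i, i < Λ a b → ∀ v, g b (M.f a b i v) = N.f a b i (g a v)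

/-- `P` is (isomorphic to) the reflection of `M` at `x`. -/
structure IsRefl (x : Fin n) (Λ : Fin n → Fin n → ℕ) (M P : RR k n)
    (c : ∀ z, P.V z →ₗ[k] M.V z) : Prop where
  bij : ∀ z, z ≠ x → Function.Bijective (c z)
  comm : ∀ a b i, a ≠ x → b ≠ x → i < Λ a b → ∀ v, c b (P.f a b i v) = M.f a b i (c a v)
  inj : ∀ v : P.V x, (∀ b i, i < Λ b x → P.f x b i v = 0) → v = 0
  zero : ∀ v : P.V x, insum x Λ M (fun b i => c b (P.f x b i v)) = 0
  exact : ∀ w, insum x Λ M w = 0 → ∃ v : P.V x, ∀ b i, i < Λ b x → c b (P.f x b i v) = w b i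

theorem exists_lift_inj {A U W : Type} [AddCommGroup A] [AddCommGroup U] [AddCommGroup W]
    [Module k A] [Module k U] [Module k W] (ι : A →ₗ[k] W) (φ : U →ₗ[k] W)
    (h : ∀ u, ∃ a, ι a = φ u) : ∃ g : U →ₗ[k] A, ∀ u, ι (g u) = φ u := by
  obtain ⟨r, hr⟩ := LinearMap.exists_rightInverse_of_surjective ι.rangeRestrict
    (LinearMap.range_rangeRestrict ι)
  refine ⟨r ∘ₗ φ.codRestrict (LinearMap.range ι) (fun u => h u), fun u => ?_⟩
  have := LinearMap.congr_fun hr (φ.codRestrict (LinearMap.range ι) (fun u => h u) u)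
  exact congrArg Subtype.val this

theorem exists_desc_surj {A U W : Type} [AddCommGroup A] [AddCommGroup U] [AddCommGroup W]
    [Module k A] [Module k U] [Module k W] (s : U →ₗ[k] A) (φ : U →ₗ[k] W)
    (hs : Function.Surjective s) (h : ∀ u, s u = 0 → φ u = 0) :
    ∃ g : A →ₗ[k] W, ∀ u, g (s u) = φ u := by
  obtain ⟨r, hr⟩ := LinearMap.exists_rightInverse_of_surjective s (LinearMap.range_eq_top.2 hs)
  refine ⟨φ ∘ₗ r, fun u => ?_⟩
  have h1 : s (r (s u) - u) = 0 := by
    rw [map_sub, sub_eq_zero]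
    exact LinearMap.congr_fun hr (s u)
  have := h _ h1
  rw [map_sub, sub_eq_zero] at this
  exact this

/-- Lifting of maps to reflections. -/
theorem refl_lift {y : Fin n} {Λ Λ' : Fin n → Fin n → ℕ} {M M' P P' : RR k n}
    {c : ∀ z, P.V z →ₗ[k] M.V z} {c' : ∀ z, P'.V z →ₗ[k] M'.V z}
    (hP : IsRefl y Λ M P c) (hP' : IsRefl y Λ' M' P' c') (hΛ : ∀ b, Λ b y = Λ' b y)
    (g : ∀ z, M.V z →ₗ[k] M'.V z)
    (hg : ∀ b i, i < Λ b y → ∀ v, g y (M.f b y i v) = M'.f b y i (g b v)) :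
    ∃ h : ∀ z, P.V z →ₗ[k] P'.V z, (∀ z, z ≠ y → ∀ v, c' z (h z v) = g z (c z v)) ∧
      ∀ b i, i < Λ b y → ∀ v, c' b (P'.f y b i (h y v)) = g b (c b (P.f y b i v)) := by
  have hy : ∃ h : P.V y →ₗ[k] P'.V y,
      ∀ b i, i < Λ b y → ∀ v, c' b (P'.f y b i (h v)) = g b (c b (P.f y b i v)) := by
    obtain ⟨h, hh⟩ := exists_lift_inj (k := k)
      (W := (b : Fin n) → (i : Fin (Λ b y)) → M'.V b)
      (LinearMap.pi fun b => LinearMap.pi fun i : Fin (Λ b y) => c' b ∘ₗ P'.f y b i)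
      (LinearMap.pi fun b => LinearMap.pi fun i : Fin (Λ b y) => g b ∘ₗ c b ∘ₗ P.f y b i)
      (by
        intro u
        have h0 := hP.zero u
        have h1 := insum_natural g hΛ hg (fun b i => c b (P.f y b i u))
        rw [h0, map_zero] at h1
        obtain ⟨v, hv⟩ := hP'.exact _ h1.symm
        refine ⟨v, ?_⟩
        funext b i
        exact hv b i (by rw [← hΛ b]; exact i.2))
    refine ⟨h, fun b i hi v => ?_⟩
    exact congrFun (congrFun (hh v) b) ⟨i, hi⟩
  obtain ⟨hy, hhy⟩ := hy
  have hz : ∀ z, ∃ h : P.V z →ₗ[k] P'.V z, z ≠ y → ∀ v, c' z (h v) = g z (c z v) := by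
    intro z
    by_cases hzy : z = y
    · exact ⟨0, fun h => absurd hzy h⟩
    · obtain ⟨h, hh⟩ := exists_lift_inj (c' z) (g z ∘ₗ c z) (fun u => (hP'.bij z hzy).2 _)
      exact ⟨h, fun _ => hh⟩
  choose h hh using hz
  refine ⟨Function.update h y hy, fun z hzy v => ?_, fun b i hi v => ?_⟩
  · rw [Function.update_of_ne hzy]; exact hh z hzy v
  · rw [Function.update_self]; exact hhy b i hi v

theorem ne_of_sink {x b : Fin n} {i : ℕ} {Λ : Fin n → Fin n → ℕ} (hx : IsSink Λ x)
    (h : i < Λ b x) : b ≠ x := by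
  rintro rfl
  rw [hx] at h
  exact absurd h (Nat.not_lt_zero _)

theorem refl_functor {y : Fin n} {Λ : Fin n → Fin n → ℕ} {M M' P P' : RR k n}
    {c : ∀ z, P.V z →ₗ[k] M.V z} {c' : ∀ z, P'.V z →ₗ[k] M'.V z} (hy : IsSink Λ y)
    (hP : IsRefl y Λ M P c) (hP' : IsRefl y Λ M' P' c')
    (g : ∀ z, M.V z →ₗ[k] M'.V z) (hg : IsHom Λ M M' g) :
    ∃ h : ∀ z, P.V z →ₗ[k] P'.V z, IsHom (flipO y Λ) P P' h ∧
      (∀ z, z ≠ y → ∀ v, c' z (h z v) = g z (c z v)) := by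
  obtain ⟨h, h1, h2⟩ := refl_lift hP hP' (fun _ => rfl) g (fun b i hi v => hg b y i hi v)
  refine ⟨h, ?_, h1⟩
  intro a b i hi v
  by_cases hb : b = y
  · subst hb; rw [flip_col, hy] at hi; exact absurd hi (Nat.not_lt_zero _)
  apply (hP'.bij b hb).1
  by_cases ha : a = y
  · subst ha
    rw [flip_row] at hi
    rw [h1 b hb, h2 b i hi]
  · rw [flip_off ha hb] at hi
    rw [h1 b hb, hP.comm a b i ha hb hi, hP'.comm a b i ha hb hi, hg a b i hi, h1 a ha]

theorem refl_ext {y : Fin n} {Λ : Fin n → Fin n → ℕ} {M' P P' : RR k n}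
    {c' : ∀ z, P'.V z →ₗ[k] M'.V z} (hy : IsSink Λ y) (hP' : IsRefl y Λ M' P' c')
    {h h' : ∀ z, P.V z →ₗ[k] P'.V z} (hh : IsHom (flipO y Λ) P P' h)
    (hh' : IsHom (flipO y Λ) P P' h') (he : ∀ z, z ≠ y → h z = h' z) : ∀ z, h z = h' z := by
  intro z
  by_cases hz : z = y
  · subst hz
    apply LinearMap.ext
    intro v
    rw [← sub_eq_zero]
    apply hP'.inj
    intro b i hi
    have hb := ne_of_sink hy hi
    have hi' : i < flipO z Λ z b := by rw [flip_row]; exact hi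
    rw [map_sub, ← hh _ _ _ hi', ← hh' _ _ _ hi', he b hb, sub_self]
  · exact he z hz

theorem IsHom.comp {Λ : Fin n → Fin n → ℕ} {M N P : RR k n} {g : ∀ z, M.V z →ₗ[k] N.V z}
    {h : ∀ z, N.V z →ₗ[k] P.V z} (hh : IsHom Λ N P h) (hg : IsHom Λ M N g) :
    IsHom Λ M P (fun z => h z ∘ₗ g z) := by
  intro a b i hi v
  simp only [LinearMap.comp_apply]
  rw [hg a b i hi, hh a b i hi]

theorem IsHom.add {Λ : Fin n → Fin n → ℕ} {M N : RR k n} {g h : ∀ z, M.V z →ₗ[k] N.V z}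
    (hg : IsHom Λ M N g) (hh : IsHom Λ M N h) : IsHom Λ M N (fun z => g z + h z) := by
  intro a b i hi v
  simp only [LinearMap.add_apply]
  rw [hg a b i hi, hh a b i hi, map_add]

theorem IsHom.id (Λ : Fin n → Fin n → ℕ) (M : RR k n) :
    IsHom Λ M M (fun _ => LinearMap.id) := fun _ _ _ _ _ => rfl

theorem IsHom.zero (Λ : Fin n → Fin n → ℕ) (M N : RR k n) :
    IsHom Λ M N (fun _ => 0) := fun _ _ _ _ _ => by simp

/-- Reflections at non-adjacent sinks commute. -/
theorem refl_comm {x y : Fin n} {Λ : Fin n → Fin n → ℕ} {M N N' P : RR k n} (hxy : x ≠ y)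
    (hx : IsSink Λ x) (hy : IsSink Λ y)
    {c : ∀ z, N.V z →ₗ[k] M.V z} {c' : ∀ z, P.V z →ₗ[k] N.V z} {c'' : ∀ z, N'.V z →ₗ[k] M.V z}
    (hN : IsRefl x Λ M N c) (hP : IsRefl y (flipO x Λ) N P c') (hN' : IsRefl y Λ M N' c'') :
    ∃ d, IsRefl x (flipO y Λ) N' P d := by
  have hyx : y ≠ x := hxy.symm
  have colx : ∀ b, flipO y Λ b x = Λ b x := by
    intro b
    by_cases hb : b = y
    · subst hb; rw [flip_row, hx, hy]
    · exact flip_off hb hxy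
  have coly : ∀ b, flipO x Λ b y = Λ b y := by
    intro b
    by_cases hb : b = x
    · subst hb; rw [flip_row, hx, hy]
    · exact flip_off hb hyx
  have nx : ∀ {b i}, i < Λ b y → b ≠ x := by
    rintro b i hi rfl
    rw [hx] at hi; exact absurd hi (Nat.not_lt_zero _)
  have ny : ∀ {b i}, i < Λ b x → b ≠ y := by
    rintro b i hi rfl
    rw [hy] at hi; exact absurd hi (Nat.not_lt_zero _)
  have cy : ∀ b i, i < flipO x Λ b y → ∀ v, c y (N.f b y i v) = M.f b y i (c b v) := by
    intro b i hi v
    rw [coly] at hi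
    exact hN.comm b y i (nx hi) hyx hi v
  obtain ⟨d, h1, h2⟩ := refl_lift hP hN' coly c cy
  have h2' : ∀ b i, i < Λ b y → ∀ v, c'' b (N'.f y b i (d y v)) = c b (c' b (P.f y b i v)) :=
    fun b i hi v => h2 b i (by rw [coly]; exact hi) v
  -- behaviour at `x`
  have px : ∀ b i, i < Λ b x → ∀ v, c' b (P.f x b i v) = N.f x b i (c' x v) := by
    intro b i hi v
    refine hP.comm x b i hxy (ny hi) ?_ v
    rw [flip_row]; exact hi
  have cx : ∀ b i, i < flipO y Λ b x → ∀ v, c'' x (N'.f b x i v) = M.f b x i (c'' b v) := by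
    intro b i hi v
    rw [colx] at hi
    exact hN'.comm b x i (ny hi) hxy hi v
  refine ⟨d, ?_, ?_, ?_, ?_, ?_⟩
  · intro z hz
    by_cases hzy : z = y
    · subst hzy
      constructor
      · rw [injective_iff_map_eq_zero]
        intro v hv
        apply hP.inj
        intro b i hi
        rw [coly] at hi
        have := h2' b i hi v
        rw [hv, map_zero, map_zero] at this
        have h3 := (injective_iff_map_eq_zero _).1 (hN.bij b (nx hi)).1 _ this.symm
        exact (injective_iff_map_eq_zero _).1 (hP.bij b (ne_of_sink hy hi)).1 _ h3
      · intro u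
        have hw : ∀ b i, ∃ w : N.V b, i < Λ b z → c b w = c'' b (N'.f z b i u) := by
          intro b i
          by_cases hi : i < Λ b z
          · obtain ⟨w, hw⟩ := (hN.bij b (nx hi)).2 (c'' b (N'.f z b i u))
            exact ⟨w, fun _ => hw⟩
          · exact ⟨0, fun h => absurd h hi⟩
        choose w hw using hw
        have h0 : insum z (flipO x Λ) N w = 0 := by
          apply (hN.bij z hz).1
          rw [map_zero, insum_natural c coly cy, ← hN'.zero u]
          exact insum_congr fun b i hi => hw b i hi
        obtain ⟨v, hv⟩ := hP.exact w h0
        refine ⟨v, ?_⟩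
        rw [← sub_eq_zero]
        apply hN'.inj
        intro b i hi
        apply (hN'.bij b (ne_of_sink hy hi)).1
        rw [map_sub, map_sub, h2' b i hi, hv b i (by rw [coly]; exact hi), hw b i hi, sub_self,
          map_zero]
    · have hcomp : Function.Bijective (fun v => c'' z (d z v)) := by
        have : (fun v => c'' z (d z v)) = fun v => c z (c' z v) := funext fun v => h1 z hzy v
        rw [this]
        exact (hN.bij z hz).comp (hP.bij z hzy)
      exact ((hN'.bij z hzy).of_comp_iff' (d z)).1 hcomp
  · intro a b i ha hb hi v
    by_cases hby : b = y
    · subst hby; rw [flip_col, hy] at hi; exact absurd hi (Nat.not_lt_zero _)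
    apply (hN'.bij b hby).1
    by_cases hay : a = y
    · subst hay
      rw [flip_row] at hi
      rw [h1 b hby, h2' b i hi]
    · rw [flip_off hay hby] at hi
      rw [h1 b hby, hP.comm a b i hay hby (by rw [flip_off ha hb]; exact hi),
        hN.comm a b i ha hb hi, hN'.comm a b i hay hby hi, h1 a hay]
  · intro v hv
    apply (hP.bij x hxy).1
    rw [map_zero]
    apply hN.inj
    intro b i hi
    rw [← px b i hi, hv b i (by rw [colx]; exact hi), map_zero]
  · intro v
    apply (hN'.bij x hxy).1
    rw [map_zero, insum_natural c'' colx cx, ← hN.zero (c' x v)]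
    refine insum_congr fun b i hi => ?_
    rw [h1 b (ny hi), px b i hi]
  · intro w hw
    have h0 : insum x Λ M (fun b i => c'' b (w b i)) = 0 := by
      rw [← insum_natural c'' colx cx, hw, map_zero]
    obtain ⟨u, hu⟩ := hN.exact _ h0
    obtain ⟨v, rfl⟩ := (hP.bij x hxy).2 u
    refine ⟨v, fun b i hi => ?_⟩
    rw [colx] at hi
    apply (hN'.bij b (ny hi)).1
    rw [h1 b (ny hi), px b i hi, hu b i hi]

/-! ## `reflPlus` is a reflection -/

theorem castL_castL {m m' : ℕ} (h : m = m') (h' : m' = m) (v : Fin m → k) :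
    castL k h' (castL k h v) = v := by
  subst h
  rfl

noncomputable def reflC (x : Fin n) (Λ : Fin n → Fin n → ℕ) (M : Rep k n Λ) (z : Fin n) :
    (toRaw (reflPlus x Λ M)).V z →ₗ[k] (toRaw M).V z :=
  if h : z = x then 0 else
    (castL k (if_neg h : (reflPlus x Λ M).d z = M.d z)).toLinearMap

theorem reflC_of_ne {x : Fin n} {Λ : Fin n → Fin n → ℕ} {M : Rep k n Λ} {z : Fin n} (h : z ≠ x)
    (v) : reflC x Λ M z v = castL k (if_neg h : (reflPlus x Λ M).d z = M.d z) v := by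
  have h1 : reflC x Λ M z =
      (castL k (if_neg h : (reflPlus x Λ M).d z = M.d z)).toLinearMap := dif_neg h
  exact LinearMap.congr_fun h1 v

theorem reflPlus_off {x : Fin n} {Λ : Fin n → Fin n → ℕ} (M : Rep k n Λ) {a b : Fin n} {i : ℕ}
    (ha : a ≠ x) (hb : b ≠ x) (hi : i < Λ a b) (v) :
    reflC x Λ M b ((toRaw (reflPlus x Λ M)).f a b i v) = (toRaw M).f a b i (reflC x Λ M a v) := by
  have hi' : i < flipO x Λ a b := by rw [flip_off ha hb]; exact hi
  rw [toRaw_f _ hi, toRaw_f _ hi', reflC_of_ne hb, reflC_of_ne ha]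
  have : (reflPlus x Λ M).f a b ⟨i, hi'⟩ = (castL k (if_neg hb).symm).toLinearMap ∘ₗ
          M.f a b ⟨i, hi⟩ ∘ₗ (castL k (if_neg ha)).toLinearMap := by
    simp only [reflPlus, ha, hb, dite_false]
    rfl
  rw [this]
  exact castL_castL (if_neg hb : (reflPlus x Λ M).d b = M.d b).symm (if_neg hb) _

theorem reflPlus_row {x : Fin n} {Λ : Fin n → Fin n → ℕ} (M : Rep k n Λ) {b : Fin n} {i : ℕ}
    (hb : b ≠ x) (hi : i < Λ b x) (v) :
    reflC x Λ M b ((toRaw (reflPlus x Λ M)).f x b i v) =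
      ((kerEquiv Λ M x).symm (castL k (if_pos rfl :
        (reflPlus x Λ M).d x = Module.finrank k (LinearMap.ker (inMap Λ M x))) v)).1 ⟨b, ⟨i, hi⟩⟩ := by
  have hi' : i < flipO x Λ x b := by rw [flip_row]; exact hi
  rw [toRaw_f _ hi', reflC_of_ne hb]
  have : (reflPlus x Λ M).f x b ⟨i, hi'⟩ = (castL k (if_neg hb).symm).toLinearMap ∘ₗ
          (LinearMap.proj (φ := fun p : Arin Λ x => Fin (M.d p.1) → k)
            (⟨b, ⟨i, hi⟩⟩ : Arin Λ x)) ∘ₗ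
          (LinearMap.ker (inMap Λ M x)).subtype ∘ₗ
          (kerEquiv Λ M x).symm.toLinearMap ∘ₗ (castL k (if_pos rfl)).toLinearMap := by
    simp only [reflPlus, hb, dite_false, dite_true]
    rfl
  rw [this]
  exact castL_castL (if_neg hb : (reflPlus x Λ M).d b = M.d b).symm (if_neg hb) _

theorem insum_toRaw (x : Fin n) (Λ : Fin n → Fin n → ℕ) (M : Rep k n Λ)
    (w : (b : Fin n) → ℕ → (toRaw M).V b) :
    insum x Λ (toRaw M) w = inMap Λ M x (fun p => w p.1 p.2) := by
  rw [insum_apply, inMap, LinearMap.sum_apply, Fintype.sum_sigma]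
  refine Finset.sum_congr rfl fun b _ => ?_
  rw [Finset.sum_range]
  refine Finset.sum_congr rfl fun i _ => ?_
  rw [toRaw_f M i.2]
  rfl

theorem reflPlus_isRefl {x : Fin n} {Λ : Fin n → Fin n → ℕ} (hx : IsSink Λ x) (M : Rep k n Λ) :
    IsRefl x Λ (toRaw M) (toRaw (reflPlus x Λ M)) (reflC x Λ M) := by
  refine ⟨?_, ?_, ?_, ?_, ?_⟩
  · intro z hz
    have : (reflC x Λ M z : _ → _) = castL k (if_neg hz : (reflPlus x Λ M).d z = M.d z) :=
      funext fun v => reflC_of_ne hz v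
    rw [this]
    exact LinearEquiv.bijective _
  · intro a b i ha hb hi v
    exact reflPlus_off M ha hb hi v
  · intro v hv
    have h0 : (kerEquiv Λ M x).symm (castL k (if_pos rfl :
        (reflPlus x Λ M).d x = Module.finrank k (LinearMap.ker (inMap Λ M x))) v) = 0 := by
      apply Subtype.ext
      funext p
      obtain ⟨b, i, hi⟩ := p
      rw [← reflPlus_row M (ne_of_sink hx hi) hi, hv b i hi, map_zero]
      rfl
    rw [LinearEquiv.map_eq_zero_iff] at h0
    exact (LinearEquiv.map_eq_zero_iff _).1 h0
  · intro v
    rw [insum_toRaw]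
    refine Eq.trans (congrArg _ ?_) ((kerEquiv Λ M x).symm (castL k (if_pos rfl :
        (reflPlus x Λ M).d x = Module.finrank k (LinearMap.ker (inMap Λ M x))) v)).2
    funext p
    obtain ⟨b, i, hi⟩ := p
    exact reflPlus_row M (ne_of_sink hx hi) hi v
  · intro w hw
    rw [insum_toRaw] at hw
    refine ⟨castL k (if_pos rfl :
        (reflPlus x Λ M).d x = Module.finrank k (LinearMap.ker (inMap Λ M x))).symm
        (kerEquiv Λ M x ⟨_, hw⟩), fun b i hi => ?_⟩
    refine (reflPlus_row M (ne_of_sink hx hi) hi _).trans ?_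
    refine (congrArg (fun u => ((kerEquiv Λ M x).symm u).1 ⟨b, ⟨i, hi⟩⟩)
      (castL_castL _ _ _)).trans ?_
    rw [LinearEquiv.symm_apply_apply]

theorem insum_agree {x : Fin n} {Λ : Fin n → Fin n → ℕ} (M : RR k n) (w) :
    insum x Λ (toRaw (ofRaw Λ M)) w = insum x Λ M w := by
  rw [insum_apply, insum_apply]
  refine Finset.sum_congr rfl fun b _ => Finset.sum_congr rfl fun i hi => ?_
  rw [toRaw_f _ (Finset.mem_range.1 hi)]

theorem exists_refl {x : Fin n} {Λ : Fin n → Fin n → ℕ} (hx : IsSink Λ x) (M : RR k n) :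
    ∃ P c, IsRefl x Λ M P c := by
  have h := reflPlus_isRefl hx (ofRaw Λ M)
  refine ⟨toRaw (reflPlus x Λ (ofRaw Λ M)), reflC x Λ (ofRaw Λ M), h.bij, ?_, h.inj, ?_, ?_⟩
  · intro a b i ha hb hi v
    rw [h.comm a b i ha hb hi, toRaw_f _ hi]
  · intro v
    exact (insum_agree M _).symm.trans (h.zero v)
  · intro w hw
    exact h.exact w ((insum_agree M w).trans hw)

/-! ## Annihilation, relationally -/

def AnnR (Λ : Fin n → Fin n → ℕ) : List (Fin n) → RR k n → Prop
  | [], M => RZero M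
  | x :: xs, M => ∃ P c, IsRefl x Λ M P c ∧ AnnR (flipO x Λ) xs P

theorem refl_zero {x : Fin n} {Λ : Fin n → Fin n → ℕ} (hx : IsSink Λ x) {M P : RR k n} {c}
    (h : IsRefl x Λ M P c) (hM : ∀ z, z ≠ x → ∀ v : M.V z, v = 0) : RZero P := by
  have h1 : ∀ z, z ≠ x → ∀ v : P.V z, v = 0 := by
    intro z hz v
    apply (h.bij z hz).1
    rw [hM z hz (c z v), map_zero]
  intro z v
  by_cases hz : z = x
  · subst hz
    apply h.inj
    intro b i hi
    exact h1 b (ne_of_sink hx hi) _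
  · exact h1 z hz v

theorem annR_zero : ∀ (T : List (Fin n)) {Λ : Fin n → Fin n → ℕ} {M : RR k n},
    Admissible Λ T → RZero M → AnnR Λ T M := by
  intro T
  induction T with
  | nil => intro Λ M _ h; exact h
  | cons x T ih =>
    intro Λ M hT h
    obtain ⟨P, c, hP⟩ := exists_refl hT.1 M
    exact ⟨P, c, hP, ih hT.2 (refl_zero hT.1 hP fun z _ v => h z v)⟩

/-- Annihilation passes to retracts. -/
theorem annR_retract : ∀ (S : List (Fin n)) {Λ : Fin n → Fin n → ℕ} {M A : RR k n},
    Admissible Λ S → AnnR Λ S M → ∀ (ι : ∀ z, A.V z →ₗ[k] M.V z) (p : ∀ z, M.V z →ₗ[k] A.V z),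
    IsHom Λ A M ι → IsHom Λ M A p → (∀ z, p z ∘ₗ ι z = LinearMap.id) → AnnR Λ S A := by
  intro S
  induction S with
  | nil =>
    intro Λ M A _ hM ι p _ _ hpi z v
    have := LinearMap.congr_fun (hpi z) v
    rw [LinearMap.comp_apply, hM z (ι z v), map_zero] at this
    exact this.symm
  | cons x S ih =>
    intro Λ M A hS hM ι p hi hp hpi
    obtain ⟨P, c, hP, hann⟩ := hM
    obtain ⟨Q, c', hQ⟩ := exists_refl hS.1 A
    obtain ⟨ι', hi', hi2⟩ := refl_functor hS.1 hQ hP ι hi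
    obtain ⟨p', hp', hp2⟩ := refl_functor hS.1 hP hQ p hp
    refine ⟨Q, c', hQ, ih hS.2 hann ι' p' hi' hp' ?_⟩
    refine refl_ext hS.1 hQ (hp'.comp hi') (IsHom.id _ _) ?_
    intro z hz
    apply LinearMap.ext
    intro v
    apply (hQ.bij z hz).1
    rw [LinearMap.comp_apply, hp2 z hz, hi2 z hz]
    exact LinearMap.congr_fun (hpi z) _

theorem annR_of_refl {x : Fin n} {S : List (Fin n)} {Λ : Fin n → Fin n → ℕ} {M P : RR k n} {c}
    (hS : Admissible Λ (x :: S)) (hP : IsRefl x Λ M P c) (h : AnnR Λ (x :: S) M) :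
    AnnR (flipO x Λ) S P := by
  obtain ⟨Q, c', hQ, hann⟩ := h
  obtain ⟨ι', hi', hi2⟩ := refl_functor hS.1 hP hQ _ (IsHom.id _ _)
  obtain ⟨p', hp', hp2⟩ := refl_functor hS.1 hQ hP _ (IsHom.id _ _)
  refine annR_retract S hS.2 hann ι' p' hi' hp' ?_
  refine refl_ext hS.1 hP (hp'.comp hi') (IsHom.id _ _) ?_
  intro z hz
  apply LinearMap.ext
  intro v
  apply (hP.bij z hz).1
  rw [LinearMap.comp_apply, hp2 z hz, LinearMap.id_apply, hi2 z hz]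
  rfl

theorem annR_cons_iff {x : Fin n} {S : List (Fin n)} {Λ : Fin n → Fin n → ℕ} {M P : RR k n} {c}
    (hS : Admissible Λ (x :: S)) (hP : IsRefl x Λ M P c) :
    AnnR Λ (x :: S) M ↔ AnnR (flipO x Λ) S P :=
  ⟨annR_of_refl hS hP, fun h => ⟨P, c, hP, h⟩⟩

theorem isZero_iff {Λ : Fin n → Fin n → ℕ} (M : Rep k n Λ) : IsZeroRep M ↔ RZero (toRaw M) := by
  constructor
  · intro h z v
    funext j
    have := j.2
    have h2 : (toRaw M).d z = 0 := h z
    omega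
  · intro h z
    by_contra hz
    have := congrFun (h z (fun _ => 1)) ⟨0, Nat.pos_of_ne_zero hz⟩
    exact one_ne_zero this

theorem annihilates_iff : ∀ (S : List (Fin n)) {Λ : Fin n → Fin n → ℕ} (M : Rep k n Λ),
    Admissible Λ S → (Annihilates Λ S M ↔ AnnR Λ S (toRaw M)) := by
  intro S
  induction S with
  | nil => intro Λ M _; exact isZero_iff M
  | cons x S ih =>
    intro Λ M hS
    rw [annR_cons_iff hS (reflPlus_isRefl hS.1 M), ← ih _ hS.2]
    rfl

/-- Annihilation of direct sums. -/
theorem annR_sum : ∀ (S : List (Fin n)) {Λ : Fin n → Fin n → ℕ} {M A B : RR k n},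
    Admissible Λ S → AnnR Λ S A → AnnR Λ S B →
    ∀ (ι : ∀ z, A.V z →ₗ[k] M.V z) (p : ∀ z, M.V z →ₗ[k] A.V z)
      (ι' : ∀ z, B.V z →ₗ[k] M.V z) (p' : ∀ z, M.V z →ₗ[k] B.V z),
    IsHom Λ A M ι → IsHom Λ M A p → IsHom Λ B M ι' → IsHom Λ M B p' →
    (∀ z, ι z ∘ₗ p z + ι' z ∘ₗ p' z = LinearMap.id) → AnnR Λ S M := by
  intro S
  induction S with
  | nil =>
    intro Λ M A B _ hA hB ι p ι' p' _ _ _ _ h z v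
    have := LinearMap.congr_fun (h z) v
    rw [LinearMap.add_apply, LinearMap.comp_apply, LinearMap.comp_apply, hA z (p z v),
      hB z (p' z v), map_zero, map_zero, add_zero] at this
    exact this.symm
  | cons x S ih =>
    intro Λ M A B hS hA hB ι p ι' p' hi hp hi' hp' h
    obtain ⟨P, c, hP, hPa⟩ := hA
    obtain ⟨Q, c', hQ, hQa⟩ := hB
    obtain ⟨N, c'', hN⟩ := exists_refl hS.1 M
    obtain ⟨j, hj, hj2⟩ := refl_functor hS.1 hP hN ι hi
    obtain ⟨q, hq, hq2⟩ := refl_functor hS.1 hN hP p hp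
    obtain ⟨j', hj', hj2'⟩ := refl_functor hS.1 hQ hN ι' hi'
    obtain ⟨q', hq', hq2'⟩ := refl_functor hS.1 hN hQ p' hp'
    refine ⟨N, c'', hN, ih hS.2 hPa hQa j q j' q' hj hq hj' hq' ?_⟩
    refine refl_ext hS.1 hN ((hj.comp hq).add (hj'.comp hq')) (IsHom.id _ _) ?_
    intro z hz
    apply LinearMap.ext
    intro v
    apply (hN.bij z hz).1
    rw [LinearMap.add_apply, LinearMap.comp_apply, LinearMap.comp_apply, map_add, hj2 z hz,
      hq2 z hz, hj2' z hz, hq2' z hz]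
    exact LinearMap.congr_fun (h z) _

theorem annR_swap {x y : Fin n} {l : List (Fin n)} {Λ : Fin n → Fin n → ℕ} {M : RR k n}
    (hxy : x ≠ y) (hx : IsSink Λ x) (hy : IsSink Λ y) (h : AnnR Λ (x :: y :: l) M) :
    AnnR Λ (y :: x :: l) M := by
  obtain ⟨N, c, hN, P, c', hP, hl⟩ := h
  obtain ⟨N', c'', hN'⟩ := exists_refl hy M
  obtain ⟨d, hd⟩ := refl_comm hxy hx hy hN hP hN'
  refine ⟨N', c'', hN', P, d, hd, ?_⟩
  rw [flip_comm]
  exact hl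

theorem annR_front {x : Fin n} : ∀ {T : List (Fin n)} {Λ : Fin n → Fin n → ℕ} {M : RR k n},
    IsSink Λ x → Admissible Λ T → x ∈ T → (AnnR Λ T M ↔ AnnR Λ (x :: T.erase x) M) := by
  intro T
  induction T with
  | nil => intro Λ M _ _ h; simp at h
  | cons y T ih =>
    intro Λ M hx hT hm
    by_cases hxy : y = x
    · subst hxy
      simp only [List.erase_cons_head]
    · have hm' : x ∈ T := by
        rcases List.mem_cons.1 hm with h | h
        · exact absurd h.symm hxy
        · exact h
      have hne : x ≠ y := fun h => hxy h.symm
      rw [List.erase_cons_tail (by simpa using hxy)]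
      have h1 : AnnR Λ (y :: T) M ↔ AnnR Λ (y :: x :: T.erase x) M := by
        constructor
        · rintro ⟨P, c, hP, h⟩
          exact ⟨P, c, hP, (ih (sink_flip hne hx hT.1) hT.2 hm').1 h⟩
        · rintro ⟨P, c, hP, h⟩
          exact ⟨P, c, hP, (ih (sink_flip hne hx hT.1) hT.2 hm').2 h⟩
      rw [h1]
      exact ⟨annR_swap hxy hT.1 hx, annR_swap hne hx hT.1⟩

theorem annR_mono : ∀ (S T : List (Fin n)) {Λ : Fin n → Fin n → ℕ} {M : RR k n},
    Admissible Λ S → Admissible Λ T → (∀ v, S.count v ≤ T.count v) → AnnR Λ S M → AnnR Λ T M := by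
  intro S
  induction S with
  | nil => intro T Λ M _ hT _ h; exact annR_zero T hT h
  | cons x S ih =>
    intro T Λ M hS hT hc h
    obtain ⟨hm, h1, _, h3⟩ := front_of_count hS hT hc
    obtain ⟨P, c, hP, h⟩ := h
    rw [annR_front hS.1 hT hm]
    exact ⟨P, c, hP, ih _ hS.2 h1 h3 h⟩

/-- Vertices not occurring in an annihilating sequence carry the zero space. -/
theorem annR_stay {z : Fin n} : ∀ (T : List (Fin n)) {Λ : Fin n → Fin n → ℕ} {M : RR k n},
    AnnR Λ T M → z ∉ T → ∀ v : M.V z, v = 0 := by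
  intro T
  induction T with
  | nil => intro Λ M h _ v; exact h z v
  | cons x T ih =>
    intro Λ M h hz v
    simp only [List.mem_cons, not_or] at hz
    obtain ⟨P, c, hP, h⟩ := h
    obtain ⟨u, rfl⟩ := (hP.bij z hz.1).2 v
    rw [ih h hz.2 u, map_zero]

theorem annR_drop_last {x : Fin n} : ∀ (T : List (Fin n)) {Λ : Fin n → Fin n → ℕ} {M : RR k n},
    AnnR Λ (T ++ [x]) M → x ∉ T → (∀ v : M.V x, v = 0) → AnnR Λ T M := by
  intro T
  induction T with
  | nil =>
    rintro Λ M ⟨P, c, hP, h⟩ _ hv z v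
    by_cases hz : z = x
    · subst hz; exact hv v
    · obtain ⟨u, rfl⟩ := (hP.bij z hz).2 v
      rw [h z u, map_zero]
  | cons y T ih =>
    rintro Λ M ⟨P, c, hP, h⟩ hx hv
    simp only [List.mem_cons, not_or] at hx
    refine ⟨P, c, hP, ih h hx.2 fun v => ?_⟩
    apply (hP.bij x hx.1).1
    rw [hv (c x v), map_zero]

/-! ## Indecomposable representations -/

def IdIndec (Λ : Fin n → Fin n → ℕ) (X : RR k n) : Prop :=
  ¬ RZero X ∧ ∀ e : ∀ z, X.V z →ₗ[k] X.V z, IsHom Λ X X e → (∀ z v, e z (e z v) = e z v) →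
    (∀ z v, e z v = 0) ∨ (∀ z v, e z v = v)

theorem idIndec_surj {x : Fin n} {Λ : Fin n → Fin n → ℕ} (hx : IsSink Λ x) {X P : RR k n} {c}
    (hX : IdIndec Λ X) (hP : IsRefl x Λ X P c) (hP0 : ¬ RZero P) :
    Function.Surjective (insum x Λ X) := by
  obtain ⟨π, hπ⟩ := LinearMap.exists_leftInverse_of_injective
    (LinearMap.range (insum x Λ X)).subtype (Submodule.ker_subtype _)
  have hπ' : ∀ u ∈ LinearMap.range (insum x Λ X), (π u : X.V x) = u := by
    intro u hu
    exact congrArg Subtype.val (LinearMap.congr_fun hπ ⟨u, hu⟩)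
  let ex : X.V x →ₗ[k] X.V x := (LinearMap.range (insum x Λ X)).subtype ∘ₗ π
  let e : ∀ z, X.V z →ₗ[k] X.V z := Function.update (fun z => LinearMap.id) x ex
  have e1 : e x = ex := Function.update_self ..
  have e2 : ∀ z, z ≠ x → e z = LinearMap.id := fun z hz => Function.update_of_ne hz ..
  have h1 : IsHom Λ X X e := by
    intro a b i hi v
    have ha : a ≠ x := by
      rintro rfl
      rw [hx] at hi; exact absurd hi (Nat.not_lt_zero _)
    rw [e2 a ha]
    by_cases hb : b = x
    · subst hb
      rw [e1]
      refine hπ' _ ⟨_, insum_single b Λ X hi v⟩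
    · rw [e2 b hb]; rfl
  have h2 : ∀ z v, e z (e z v) = e z v := by
    intro z v
    by_cases hz : z = x
    · subst hz
      rw [e1]
      exact hπ' _ (π v).2
    · rw [e2 z hz]; rfl
  rcases hX.2 e h1 h2 with h | h
  · exfalso
    refine hP0 (refl_zero hx hP fun z hz v => ?_)
    have := h z v
    rw [e2 z hz] at this
    exact this
  · intro u
    have := h x u
    rw [e1] at this
    rw [← this]
    exact (π u).2

theorem idIndec_refl {x : Fin n} {Λ : Fin n → Fin n → ℕ} (hx : IsSink Λ x) {X P : RR k n} {c}
    (hX : IdIndec Λ X) (hP : IsRefl x Λ X P c) (hP0 : ¬ RZero P) : IdIndec (flipO x Λ) P := by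
  have hs := idIndec_surj hx hX hP hP0
  refine ⟨hP0, fun e he hid => ?_⟩
  -- transport of `e` away from `x`
  have hg : ∀ z, ∃ g : X.V z →ₗ[k] X.V z, z ≠ x → ∀ v, g (c z v) = c z (e z v) := by
    intro z
    by_cases hz : z = x
    · exact ⟨0, fun h => absurd hz h⟩
    · obtain ⟨g, hg⟩ := exists_desc_surj (c z) (c z ∘ₗ e z) (hP.bij z hz).2 (by
        intro u hu
        have := (injective_iff_map_eq_zero _).1 (hP.bij z hz).1 u hu
        rw [this, map_zero])
      exact ⟨g, fun _ => hg⟩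
  choose g hg using hg
  let G : ((b : Fin n) → ℕ → X.V b) →ₗ[k] ((b : Fin n) → ℕ → X.V b) :=
    LinearMap.pi fun b => LinearMap.pi fun i => g b ∘ₗ LinearMap.proj i ∘ₗ LinearMap.proj b
  have hG : ∀ w b i, G w b i = g b (w b i) := fun _ _ _ => rfl
  obtain ⟨gx, hgx⟩ := exists_desc_surj (insum x Λ X) (insum x Λ X ∘ₗ G) hs (by
    intro w hw
    obtain ⟨v, hv⟩ := hP.exact w hw
    rw [LinearMap.comp_apply, ← hP.zero (e x v)]
    refine insum_congr fun b i hi => ?_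
    rw [hG, ← hv b i hi, hg b (ne_of_sink hx hi), he x b i (by rw [flip_row]; exact hi)])
  let E : ∀ z, X.V z →ₗ[k] X.V z := Function.update g x gx
  have e1 : E x = gx := Function.update_self ..
  have e2 : ∀ z, z ≠ x → E z = g z := fun z hz => Function.update_of_ne hz ..
  have gid : ∀ z, z ≠ x → ∀ v, g z (g z v) = g z v := by
    intro z hz v
    obtain ⟨u, rfl⟩ := (hP.bij z hz).2 v
    rw [hg z hz, hg z hz, hid]
  have hE : IsHom Λ X X E := by
    intro a b i hi v
    have ha : a ≠ x := by
      rintro rfl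
      rw [hx] at hi; exact absurd hi (Nat.not_lt_zero _)
    rw [e2 a ha]
    by_cases hb : b = x
    · subst hb
      rw [e1, ← insum_single b Λ X hi v, hgx, LinearMap.comp_apply,
        ← insum_single b Λ X hi (g a v)]
      congr 1
      funext b' i'
      rw [hG]
      by_cases h1 : b' = a
      · subst h1
        by_cases h2 : i' = i
        · subst h2; simp
        · simp [h2]
      · simp [h1]
    · rw [e2 b hb]
      obtain ⟨u, rfl⟩ := (hP.bij a ha).2 v
      rw [hg a ha, ← hP.comm a b i ha hb hi, ← hP.comm a b i ha hb hi, hg b hb,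
        he a b i (by rw [flip_off ha hb]; exact hi)]
  have hEid : ∀ z v, E z (E z v) = E z v := by
    intro z v
    by_cases hz : z = x
    · subst hz
      rw [e1]
      obtain ⟨w, rfl⟩ := hs v
      rw [hgx, LinearMap.comp_apply, hgx, LinearMap.comp_apply]
      refine insum_congr fun b i hi => ?_
      rw [hG, hG, gid b (ne_of_sink hx hi)]
    · rw [e2 z hz]; exact gid z hz v
  rcases hX.2 E hE hEid with h | h
  · left
    have : ∀ z, e z = 0 := refl_ext hx hP he (IsHom.zero _ _ _) (by
      intro z hz
      apply LinearMap.ext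
      intro v
      apply (hP.bij z hz).1
      have := h z (c z v)
      rw [e2 z hz, hg z hz] at this
      rw [this]; simp)
    intro z v; rw [this z]; rfl
  · right
    have : ∀ z, e z = LinearMap.id := refl_ext hx hP he (IsHom.id _ _) (by
      intro z hz
      apply LinearMap.ext
      intro v
      apply (hP.bij z hz).1
      have := h z (c z v)
      rw [e2 z hz, hg z hz] at this
      rw [this]; simp)
    intro z v; rw [this z]; rfl

/-- The key fact: annihilation of an indecomposable is governed by a single multiplicity. -/
theorem key : ∀ (S : List (Fin n)) {Λ : Fin n → Fin n → ℕ} {X : RR k n}, IdIndec Λ X →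
    Admissible Λ S → AnnR Λ S X →
    ∃ v r, 1 ≤ r ∧ ∀ T, Admissible Λ T → (AnnR Λ T X ↔ r ≤ T.count v) := by
  intro S
  induction S with
  | nil => intro Λ X hX _ h; exact absurd h hX.1
  | cons x S ih =>
    intro Λ X hX hS h
    obtain ⟨P, c, hP, h⟩ := h
    by_cases hP0 : RZero P
    · refine ⟨x, 1, le_rfl, fun T hT => ?_⟩
      have hiff : 1 ≤ T.count x ↔ x ∈ T := List.count_pos_iff
      rw [hiff]
      have hsupp : ∀ z, z ≠ x → ∀ v : X.V z, v = 0 := by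
        intro z hz v
        obtain ⟨u, rfl⟩ := (hP.bij z hz).2 v
        rw [hP0 z u, map_zero]
      constructor
      · intro hann
        by_contra hm
        apply hX.1
        intro z v
        by_cases hz : z = x
        · subst hz; exact annR_stay T hann hm v
        · exact hsupp z hz v
      · intro hm
        rw [annR_front hS.1 hT hm]
        exact ⟨P, c, hP, annR_zero _ (front hS.1 hT hm).1 hP0⟩
    · have hs := idIndec_surj hS.1 hX hP hP0
      obtain ⟨v, r, hr, hT⟩ := ih (idIndec_refl hS.1 hX hP hP0) hS.2 h
      refine ⟨v, r + if x = v then 1 else 0, by omega, fun T hTa => ?_⟩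
      by_cases hm : x ∈ T
      · obtain ⟨h1, h2⟩ := front hS.1 hTa hm
        rw [annR_front hS.1 hTa hm, annR_cons_iff ⟨hS.1, h1⟩ hP, hT _ h1, h2.perm.count_eq v,
          List.count_cons]
        by_cases hv : x = v <;> simp [hv]
      · have hTf := adm_flip_of_notMem hS.1 hTa hm
        have hTx := adm_append_sink hS.1 hTa hm
        have hfr : AnnR Λ (T ++ [x]) X ↔ AnnR (flipO x Λ) T P := by
          rw [annR_front hS.1 hTx (by simp), List.erase_append_right _ hm, List.erase_cons_head,
            List.append_nil, annR_cons_iff ⟨hS.1, hTf⟩ hP]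
        have hxv : r ≤ T.count v → x ≠ v := by
          rintro h rfl
          exact hm (List.count_pos_iff.1 (by omega))
        constructor
        · intro hann
          have h1 : r ≤ T.count v := by
            rw [← hT T hTf, ← hfr]
            exact annR_mono T _ hTa hTx (by intro v; simp [List.count_append]) hann
          simp [hxv h1, h1]
        · intro hle
          have h1 : r ≤ T.count v := by omega
          have h2 := hfr.2 ((hT T hTf).2 h1)
          refine annR_drop_last T h2 hm fun u => ?_
          obtain ⟨w, rfl⟩ := hs u
          rw [← map_zero (insum x Λ X)]
          refine insum_congr fun b i hi => ?_
          refine annR_stay (T ++ [x]) h2 ?_ _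
          simp only [List.mem_append, List.mem_singleton, not_or]
          exact ⟨nbr_notMem hS.1 hTa hm (by omega), ne_of_sink hS.1 hi⟩

/-! ## Direct sums and decompositions -/

theorem repIso_dSum_iff {Λ : Fin n → Fin n → ℕ} (M A B : Rep k n Λ) :
    RepIso M (dSum A B) ↔
      ∃ g : ∀ z, (Fin (M.d z) → k) ≃ₗ[k] (Fin (A.d z) → k) × (Fin (B.d z) → k),
        ∀ a b i v, g b (M.f a b i v) = (A.f a b i (g a v).1, B.f a b i (g a v).2) := by
  constructor
  · rintro ⟨g, hg⟩
    refine ⟨fun z => (g z).trans (splitL k (A.d z) (B.d z)), fun a b i v => ?_⟩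
    have h1 := congrArg (splitL k (A.d b) (B.d b)) (hg a b i v)
    have h2 : (splitL k (A.d b) (B.d b)) ((dSum A B).f a b i (g a v)) =
        (LinearMap.prodMap (A.f a b i) (B.f a b i)) (splitL k (A.d a) (B.d a) (g a v)) :=
      LinearEquiv.apply_symm_apply _ _
    exact h1.trans h2
  · rintro ⟨g, hg⟩
    refine ⟨fun z => (g z).trans (splitL k (A.d z) (B.d z)).symm, fun a b i v => ?_⟩
    have h1 := congrArg (splitL k (A.d b) (B.d b)).symm (hg a b i v)
    refine h1.trans ?_
    have h2 : (dSum A B).f a b i ((splitL k (A.d a) (B.d a)).symm (g a v)) =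
        (splitL k (A.d b) (B.d b)).symm ((LinearMap.prodMap (A.f a b i) (B.f a b i))
          (splitL k (A.d a) (B.d a) ((splitL k (A.d a) (B.d a)).symm (g a v)))) := rfl
    refine Eq.trans ?_ h2.symm
    rw [LinearEquiv.apply_symm_apply]
    rfl

theorem dSum_symm {Λ : Fin n → Fin n → ℕ} {M A B : Rep k n Λ} (h : RepIso M (dSum A B)) :
    RepIso M (dSum B A) := by
  rw [repIso_dSum_iff] at h ⊢
  obtain ⟨g, hg⟩ := h
  refine ⟨fun z => (g z).trans (LinearEquiv.prodComm k _ _), fun a b i v => ?_⟩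
  simp [hg]

theorem summand_trans {Λ : Fin n → Fin n → ℕ} {M A B Y : Rep k n Λ} (h : RepIso M (dSum A B))
    (hY : IsSummand Y A) : IsSummand Y M := by
  obtain ⟨C, hC⟩ := hY
  refine ⟨dSum C B, ?_⟩
  have hCB : RepIso (dSum C B) (dSum C B) := ⟨fun z => LinearEquiv.refl _ _, fun _ _ _ _ => rfl⟩
  rw [repIso_dSum_iff] at h hC hCB ⊢
  obtain ⟨g, hg⟩ := h
  obtain ⟨g', hg'⟩ := hC
  obtain ⟨q, hq⟩ := hCB
  refine ⟨fun z => (g z).trans (((g' z).prodCongr (LinearEquiv.refl k _)).trans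
    ((LinearEquiv.prodAssoc k _ _ _).trans
      ((LinearEquiv.refl k _).prodCongr (q z).symm))), fun a b i v => ?_⟩
  refine Prod.ext ?_ ?_
  · simp [hg, hg']
  · apply (q b).injective
    simp [hg, hg', hq]

theorem summand_self {Λ : Fin n → Fin n → ℕ} (M : Rep k n Λ) : IsSummand M M := by
  refine ⟨zeroRep k n Λ, ?_⟩
  rw [repIso_dSum_iff]
  refine ⟨fun z => ?_, ?_⟩
  · haveI : Unique (Fin ((zeroRep k n Λ).d z) → k) :=
      { default := 0, uniq := fun v => funext fun j => Fin.elim0 j }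
    exact (LinearEquiv.prodUnique (R := k)).symm
  · intro a b i v
    refine Prod.ext rfl ?_
    funext j
    exact Fin.elim0 j

theorem ann_dSum {Λ : Fin n → Fin n → ℕ} {M A B : Rep k n Λ} (h : RepIso M (dSum A B))
    {S : List (Fin n)} (hS : Admissible Λ S) :
    Annihilates Λ S M ↔ Annihilates Λ S A ∧ Annihilates Λ S B := by
  rw [annihilates_iff S M hS, annihilates_iff S A hS, annihilates_iff S B hS]
  rw [repIso_dSum_iff] at h
  obtain ⟨g, hg⟩ := h
  have hg' : ∀ a b i w, (g b).symm (A.f a b i w.1, B.f a b i w.2) = M.f a b i ((g a).symm w) := by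
    intro a b i w
    rw [LinearEquiv.symm_apply_eq, hg, LinearEquiv.apply_symm_apply]
  let iA : ∀ z, (toRaw A).V z →ₗ[k] (toRaw M).V z := fun z =>
    (g z).symm.toLinearMap ∘ₗ LinearMap.inl k _ _
  let iB : ∀ z, (toRaw B).V z →ₗ[k] (toRaw M).V z := fun z =>
    (g z).symm.toLinearMap ∘ₗ LinearMap.inr k _ _
  let pA : ∀ z, (toRaw M).V z →ₗ[k] (toRaw A).V z := fun z =>
    LinearMap.fst k _ _ ∘ₗ (g z).toLinearMap
  let pB : ∀ z, (toRaw M).V z →ₗ[k] (toRaw B).V z := fun z =>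
    LinearMap.snd k _ _ ∘ₗ (g z).toLinearMap
  have hiA : IsHom Λ (toRaw A) (toRaw M) iA := by
    intro a b i hi v
    rw [toRaw_f _ hi, toRaw_f _ hi]
    have := hg' a b ⟨i, hi⟩ (v, 0)
    simpa [iA] using this
  have hiB : IsHom Λ (toRaw B) (toRaw M) iB := by
    intro a b i hi v
    rw [toRaw_f _ hi, toRaw_f _ hi]
    have := hg' a b ⟨i, hi⟩ (0, v)
    simpa [iB] using this
  have hpA : IsHom Λ (toRaw M) (toRaw A) pA := by
    intro a b i hi v
    rw [toRaw_f _ hi, toRaw_f _ hi]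
    exact congrArg Prod.fst (hg a b ⟨i, hi⟩ v)
  have hpB : IsHom Λ (toRaw M) (toRaw B) pB := by
    intro a b i hi v
    rw [toRaw_f _ hi, toRaw_f _ hi]
    exact congrArg Prod.snd (hg a b ⟨i, hi⟩ v)
  constructor
  · intro h
    refine ⟨annR_retract S hS h iA pA hiA hpA ?_, annR_retract S hS h iB pB hiB hpB ?_⟩
    · intro z
      apply LinearMap.ext
      intro v
      simp [iA, pA]
    · intro z
      apply LinearMap.ext
      intro v
      simp [iB, pB]
  · rintro ⟨h1, h2⟩
    refine annR_sum S hS h1 h2 iA pA iB pB hiA hpA hiB hpB ?_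
    intro z
    apply LinearMap.ext
    intro v
    apply (g z).injective
    simp [iA, pA, iB, pB]

/-- Splitting along an invariant pair of complementary subspaces. -/
theorem split_of_isCompl {Λ : Fin n → Fin n → ℕ} (M : Rep k n Λ)
    (U W : ∀ z, Submodule k (Fin (M.d z) → k)) (hUW : ∀ z, IsCompl (U z) (W z))
    (hU : ∀ a b i, ∀ v ∈ U a, M.f a b i v ∈ U b) (hW : ∀ a b i, ∀ v ∈ W a, M.f a b i v ∈ W b) :
    ∃ A B : Rep k n Λ, RepIso M (dSum A B) ∧ (∀ z, A.d z = Module.finrank k (U z)) ∧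
      ∀ z, B.d z = Module.finrank k (W z) := by
  let eU : ∀ z, U z ≃ₗ[k] (Fin (Module.finrank k (U z)) → k) := fun z =>
    (Module.finBasis k (U z)).equivFun
  let eW : ∀ z, W z ≃ₗ[k] (Fin (Module.finrank k (W z)) → k) := fun z =>
    (Module.finBasis k (W z)).equivFun
  let A : Rep k n Λ :=
    { d := fun z => Module.finrank k (U z)
      f := fun a b i => (eU b).toLinearMap ∘ₗ
        ((M.f a b i).restrict (fun v hv => hU a b i v hv)) ∘ₗ (eU a).symm.toLinearMap }
  let B : Rep k n Λ :=
    { d := fun z => Module.finrank k (W z)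
      f := fun a b i => (eW b).toLinearMap ∘ₗ
        ((M.f a b i).restrict (fun v hv => hW a b i v hv)) ∘ₗ (eW a).symm.toLinearMap }
  refine ⟨A, B, ?_, fun _ => rfl, fun _ => rfl⟩
  rw [repIso_dSum_iff]
  refine ⟨fun z => ((Submodule.prodEquivOfIsCompl (U z) (W z) (hUW z)).symm.trans
    ((eU z).prodCongr (eW z))), fun a b i v => ?_⟩
  obtain ⟨⟨u, w⟩, rfl⟩ := (Submodule.prodEquivOfIsCompl (U a) (W a) (hUW a)).surjective v
  have h1 : M.f a b i (Submodule.prodEquivOfIsCompl (U a) (W a) (hUW a) (u, w)) =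
      Submodule.prodEquivOfIsCompl (U b) (W b) (hUW b)
        (⟨M.f a b i u, hU a b i _ u.2⟩, ⟨M.f a b i w, hW a b i _ w.2⟩) := by
    simp
  rw [h1]
  simp only [LinearEquiv.trans_apply, LinearEquiv.symm_apply_apply]
  refine Prod.ext ?_ ?_
  · simp [A, LinearMap.restrict_apply]
  · simp [B, LinearMap.restrict_apply]

theorem indecomp_idIndec {Λ : Fin n → Fin n → ℕ} {M : Rep k n Λ} (h : Indecomp M) :
    IdIndec Λ (toRaw M) := by
  refine ⟨fun h0 => h.1 ((isZero_iff M).2 h0), fun e he hid => ?_⟩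
  have he' : ∀ a b i v, e b (M.f a b i v) = M.f a b i (e a v) := by
    intro a b i v
    have := he a b i i.2 v
    rw [toRaw_f _ i.2] at this
    exact this
  obtain ⟨A, B, hAB, hA, hB⟩ := split_of_isCompl M (fun z => LinearMap.range (e z))
    (fun z => LinearMap.ker (e z))
    (by
      intro z
      constructor
      · rw [Submodule.disjoint_def]
        rintro _ ⟨v, rfl⟩ hv
        rw [LinearMap.mem_ker, hid] at hv
        exact hv
      · rw [codisjoint_iff_le_sup]
        intro v _
        rw [Submodule.mem_sup]
        refine ⟨e z v, ⟨v, rfl⟩, v - e z v, ?_, by abel⟩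
        rw [LinearMap.mem_ker, map_sub, hid, sub_self])
    (by
      rintro a b i _ ⟨v, rfl⟩
      exact ⟨M.f a b i v, he' a b i v⟩)
    (by
      intro a b i v hv
      rw [LinearMap.mem_ker] at hv ⊢
      rw [he', hv, map_zero])
  rcases h.2 A B hAB with h0 | h0
  · left
    intro z v
    have h1 := h0 z
    rw [hA, Submodule.finrank_eq_zero] at h1
    have : e z v ∈ LinearMap.range (e z) := ⟨v, rfl⟩
    rw [h1] at this
    exact (Submodule.mem_bot k).1 this
  · right
    intro z v
    have h1 := h0 z
    rw [hB, Submodule.finrank_eq_zero] at h1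
    have : v - e z v ∈ LinearMap.ker (e z) := by
      rw [LinearMap.mem_ker, map_sub, hid, sub_self]
    rw [h1, Submodule.mem_bot, sub_eq_zero] at this
    exact this.symm

/-! ## Minimal annihilators -/

def MinAnn (Λ : Fin n → Fin n → ℕ) (M : Rep k n Λ) (S : List (Fin n)) : Prop :=
  Admissible Λ S ∧ ∀ T, Admissible Λ T → (Annihilates Λ T M ↔ ∀ v, S.count v ≤ T.count v)

theorem shortest_iff {Λ : Fin n → Fin n → ℕ} {M : Rep k n Λ} {S : List (Fin n)}
    (hS : MinAnn Λ M S) (S' : List (Fin n)) :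
    IsShortestAnn Λ M S' ↔ Admissible Λ S' ∧ ∀ v, S'.count v = S.count v := by
  constructor
  · rintro ⟨h1, h2, h3⟩
    refine ⟨h1, fun v => ?_⟩
    have := h3 S hS.1 ((hS.2 S hS.1).2 fun _ => le_rfl)
      (preceq_of_count S S' Λ hS.1 h1 ((hS.2 S' h1).1 h2))
    exact (this.perm.count_eq v).symm
  · rintro ⟨h1, h2⟩
    refine ⟨h1, (hS.2 S' h1).2 fun v => (h2 v).ge, fun T hT hTa hTp => ?_⟩
    refine sim_of_count hT h1 fun v => le_antisymm (hTp.count v) ?_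
    rw [h2]
    exact (hS.2 T hT).1 hTa v

theorem key' {Λ : Fin n → Fin n → ℕ} {X : Rep k n Λ} (hX : Indecomp X) (hp : Preprojective Λ X) :
    ∃ v r, 1 ≤ r ∧ ∀ T, Admissible Λ T → (Annihilates Λ T X ↔ r ≤ T.count v) := by
  obtain ⟨S, hS, hann⟩ := hp
  obtain ⟨v, r, hr, h⟩ := key S (indecomp_idIndec hX) hS ((annihilates_iff S X hS).1 hann)
  exact ⟨v, r, hr, fun T hT => by rw [annihilates_iff T X hT, h T hT]⟩

theorem indecomp_minAnn {Λ : Fin n → Fin n → ℕ} {X : Rep k n Λ} (hX : Indecomp X)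
    (hp : Preprojective Λ X) : ∃ S, MinAnn Λ X S := by
  obtain ⟨v, r, -, h⟩ := key' hX hp
  obtain ⟨S, hS, hann⟩ := hp
  have hex : ∃ l, ∃ S : List (Fin n), S.length = l ∧ Admissible Λ S ∧ r ≤ S.count v :=
    ⟨_, S, rfl, hS, (h S hS).1 hann⟩
  classical
  obtain ⟨S, hl, hS, hr⟩ := Nat.find_spec hex
  refine ⟨S, hS, fun T hT => ?_⟩
  rw [h T hT]
  constructor
  · intro hT' u
    obtain ⟨R, hR, hc⟩ := exists_meet S T Λ hS hT
    have h1 : S.length ≤ R.length := by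
      rw [hl]
      exact Nat.find_min' hex ⟨R, rfl, hR, by rw [hc]; exact le_min hr hT'⟩
    obtain ⟨U, _, hU⟩ := preceq_of_count R S Λ hR hS (fun w => by rw [hc]; exact min_le_left _ _)
    have h2 := hU.perm.length_eq
    rw [List.length_append] at h2
    have h3 : U = [] := List.length_eq_zero_iff.1 (by omega)
    have h4 := hU.perm.count_eq u
    rw [h3, List.append_nil, hc] at h4
    omega
  · intro hu
    exact hr.trans (hu v)

theorem exists_minAnn : ∀ (N : ℕ) {Λ : Fin n → Fin n → ℕ} (M : Rep k n Λ), ∑ z, M.d z ≤ N →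
    Preprojective Λ M →
    ∃ S, MinAnn Λ M S ∧ ∀ v, S.count v ≠ 0 → ∃ Y, Indecomp Y ∧ IsSummand Y M ∧
      ∃ SY, MinAnn Λ Y SY ∧ S.count v = SY.count v := by
  intro N
  induction N with
  | zero =>
    intro Λ M hd hp
    have h0 : IsZeroRep M := by
      intro z
      have := Finset.single_le_sum (f := M.d) (fun _ _ => Nat.zero_le _) (Finset.mem_univ z)
      omega
    refine ⟨[], ⟨trivial, fun T hT => ?_⟩, by simp⟩
    simp only [List.count_nil, Nat.zero_le, implies_true, iff_true]
    rw [annihilates_iff T M hT]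
    exact annR_zero T hT ((isZero_iff M).1 h0)
  | succ N ih =>
    intro Λ M hd hp
    by_cases h0 : IsZeroRep M
    · refine ih M ?_ hp
      rw [Finset.sum_eq_zero fun z _ => h0 z]
      exact Nat.zero_le _
    by_cases hI : Indecomp M
    · obtain ⟨S, hS⟩ := indecomp_minAnn hI hp
      exact ⟨S, hS, fun v _ => ⟨M, hI, summand_self M, S, hS, rfl⟩⟩
    have hdec : ∃ A B : Rep k n Λ, RepIso M (dSum A B) ∧ ¬ IsZeroRep A ∧ ¬ IsZeroRep B := by
      by_contra hcon
      refine hI ⟨h0, fun A B hAB => ?_⟩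
      by_contra h
      exact hcon ⟨A, B, hAB, fun h' => h (Or.inl h'), fun h' => h (Or.inr h')⟩
    obtain ⟨A, B, hAB, hA, hB⟩ := hdec
    have hdim : ∑ z, M.d z = ∑ z, A.d z + ∑ z, B.d z := by
      rw [← Finset.sum_add_distrib]
      refine Finset.sum_congr rfl fun z _ => ?_
      obtain ⟨g, -⟩ := hAB
      have := (g z).finrank_eq
      rw [Module.finrank_fin_fun, Module.finrank_fin_fun] at this
      exact this
    have hpos : ∀ C : Rep k n Λ, ¬ IsZeroRep C → 0 < ∑ z, C.d z := by
      intro C hC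
      by_contra h
      apply hC
      intro z
      have := Finset.single_le_sum (f := C.d) (fun _ _ => Nat.zero_le _) (Finset.mem_univ z)
      omega
    have hA' := hpos A hA
    have hB' := hpos B hB
    obtain ⟨T, hT, hTa⟩ := hp
    have hTab := (ann_dSum hAB hT).1 hTa
    obtain ⟨SA, hSA, hSA2⟩ := ih A (by omega) ⟨T, hT, hTab.1⟩
    obtain ⟨SB, hSB, hSB2⟩ := ih B (by omega) ⟨T, hT, hTab.2⟩
    obtain ⟨J, hJ, hJc⟩ := exists_join SA SB Λ hSA.1 hSB.1
    refine ⟨J, ⟨hJ, fun T hT => ?_⟩, fun v hv => ?_⟩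
    · rw [ann_dSum hAB hT, hSA.2 T hT, hSB.2 T hT, ← forall_and]
      refine forall_congr' fun v => ?_
      rw [hJc, max_le_iff]
    · rw [hJc] at hv ⊢
      rcases le_total (SA.count v) (SB.count v) with h | h
      · rw [max_eq_right h] at hv ⊢
        obtain ⟨Y, h1, h2, h3⟩ := hSB2 v hv
        exact ⟨Y, h1, summand_trans (dSum_symm hAB) h2, h3⟩
      · rw [max_eq_left h] at hv ⊢
        obtain ⟨Y, h1, h2, h3⟩ := hSA2 v hv
        exact ⟨Y, h1, summand_trans hAB h2, h3⟩

theorem shortest_preceq_iff_summandwise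
    (n : ℕ) (hn : 2 ≤ n) (Λ : Fin n → Fin n → ℕ)
    (hloop : ∀ a, Λ a a = 0)
    (hconn : ∀ a b : Fin n, Relation.ReflTransGen (fun u v => edges Λ u v ≠ 0) a b)
    (hacyc : ∀ a : Fin n, ¬ Relation.TransGen (fun u v => Λ u v ≠ 0) a a)
    (k : Type) [Field k]
    (L M : Rep k n Λ) (hL : Preprojective Λ L) (hM : Preprojective Λ M)
    (SL SM : List (Fin n)) (hSL : IsShortestAnn Λ L SL) (hSM : IsShortestAnn Λ M SM) :
    Preceq Λ SL SM ↔
      ∀ X : Rep k n Λ, Indecomp X → IsSummand X L →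
        ∃ Y : Rep k n Λ, Indecomp Y ∧ IsSummand Y M ∧
          ∀ SX, IsShortestAnn Λ X SX → ∃ SY, IsShortestAnn Λ Y SY ∧ Preceq Λ SX SY := by
  obtain ⟨ML, hML, hML2⟩ := exists_minAnn _ L le_rfl hL
  obtain ⟨MM, hMM, hMM2⟩ := exists_minAnn _ M le_rfl hM
  obtain ⟨aL, cL⟩ := (shortest_iff hML SL).1 hSL
  obtain ⟨aM, cM⟩ := (shortest_iff hMM SM).1 hSM
  constructor
  · intro hle X hX hXL
    obtain ⟨C, hC⟩ := hXL
    have hXa : Annihilates Λ SL X := ((ann_dSum hC aL).1 hSL.2.1).1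
    have hXp : Preprojective Λ X := ⟨SL, aL, hXa⟩
    obtain ⟨v, r, hr, hv⟩ := key' hX hXp
    obtain ⟨S, hS⟩ := indecomp_minAnn hX hXp
    have h1 : r ≤ MM.count v := by
      rw [← cM]
      exact ((hv SL aL).1 hXa).trans (hle.count v)
    obtain ⟨Y, hY, hYM, SY, hSY, hc⟩ := hMM2 v (by omega)
    refine ⟨Y, hY, hYM, fun SX hSX => ⟨SY, (shortest_iff hSY SY).2 ⟨hSY.1, fun _ => rfl⟩, ?_⟩⟩
    obtain ⟨aX, cX⟩ := (shortest_iff hS SX).1 hSX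
    refine preceq_of_count SX SY Λ aX hSY.1 fun u => ?_
    rw [cX]
    refine (hS.2 SY hSY.1).1 ((hv SY hSY.1).2 ?_) u
    rw [← hc]
    exact h1
  · intro h
    refine preceq_of_count SL SM Λ aL aM fun v => ?_
    rw [cL]
    by_cases hv : ML.count v = 0
    · omega
    obtain ⟨X, hX, hXL, SX, hSX, hc⟩ := hML2 v hv
    obtain ⟨Y, hY, ⟨C, hC⟩, hYX⟩ := h X hX hXL
    obtain ⟨SY, hSY, hle⟩ := hYX SX ((shortest_iff hSX SX).2 ⟨hSX.1, fun _ => rfl⟩)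
    have hYa : Annihilates Λ SM Y := ((ann_dSum hC aM).1 hSM.2.1).1
    obtain ⟨S, hS⟩ := indecomp_minAnn hY ⟨SM, aM, hYa⟩
    obtain ⟨aY, cY⟩ := (shortest_iff hS SY).1 hSY
    rw [hc]
    refine (hle.count v).trans ?_
    rw [cY]
    exact (hS.2 SM aM).1 hYa v

end KP
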